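/- arXiv:2505.07967 — 2 statements merged into one kernel-verified Lean document; each statement's English description precedes it below -/
import Mathlib

section
/- There is an absolute constant C > 0 with the following property. Fix d, m, L ∈ ℕ with m ≥ 2, an architecture (d₀ = d, d₁, …, d_L, d_{L+1} = 1) with size 𝒮 = Σ_{s=0}^{L−1} d_{s+1}(d_s + 1), and K, u > 0. Then there exists a finite set T of functions on [0,1]^d with cardinality |T| ≤ exp( C·𝒮·log(1 + K/u) ) such that every g ∈ 𝒩_K admits some g̃ ∈ T with sup_{x ∈ [0,1]^d} |g(x) − g̃(x)| ≤ u. In other words, the u-covering number of 𝒩_K in the supremum norm has logarithm at most C·𝒮·log(1 + K/u). -/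
/-- RePU activation of order `m`: `σ_m(t) = (max{t,0})^m`. -/
noncomputable def repu (m : ℕ) (t : ℝ) : ℝ := (max t 0) ^ m

/-- Hidden-layer forward pass of a RePU network with architecture `arch`
(`arch 0` input units, `arch ℓ` units at layer `ℓ`), weight matrices `A` and biases `b`:
`netFwd m arch A b x ℓ` is the output of the `ℓ`-th hidden layer at input `x`. -/
noncomputable def netFwd (m : ℕ) (arch : ℕ → ℕ)
    (A : ∀ ℓ : ℕ, Matrix (Fin (arch (ℓ + 1))) (Fin (arch ℓ)) ℝ)
    (b : ∀ ℓ : ℕ, Fin (arch (ℓ + 1)) → ℝ)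
    (x : Fin (arch 0) → ℝ) : (ℓ : ℕ) → Fin (arch ℓ) → ℝ
  | 0 => x
  | ℓ + 1 => fun i => repu m ((A ℓ).mulVec (netFwd m arch A b x ℓ) i + b ℓ i)

/-- Real output of a depth-`L` RePU network (the output layer `g_L(x) = A_L x` has one
unit, `arch (L+1) = 1`; we sum the coordinates of the output vector). -/
noncomputable def netOut (m : ℕ) (arch : ℕ → ℕ)
    (A : ∀ ℓ : ℕ, Matrix (Fin (arch (ℓ + 1))) (Fin (arch ℓ)) ℝ)
    (b : ∀ ℓ : ℕ, Fin (arch (ℓ + 1)) → ℝ) (L : ℕ) (x : Fin (arch 0) → ℝ) : ℝ :=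
  ∑ i, (A L).mulVec (netFwd m arch A b x L) i

/-- The `ℓ∞` operator norm of a matrix: `‖A‖_∞ = max_i Σ_j |a_{ij}|`. -/
noncomputable def matInfNorm {p q : ℕ} (A : Matrix (Fin p) (Fin q) ℝ) : ℝ :=
  ⨆ i, ∑ j, |A i j|

/-- `‖(A, b)‖_∞`, the `ℓ∞` operator norm of `A` augmented with the column `b`. -/
noncomputable def augInfNorm {p q : ℕ} (A : Matrix (Fin p) (Fin q) ℝ) (b : Fin p → ℝ) : ℝ :=
  ⨆ i, ((∑ j, |A i j|) + |b i|)

/-- Norm-constraint functional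
`κ(θ) = m^L ‖A_L‖_∞ ∏_{s=0}^{L−1} max{‖(A_s, b_s)‖_∞, 1}^{m^{L−s}}`. -/
noncomputable def kappa (m L : ℕ) (arch : ℕ → ℕ)
    (A : ∀ ℓ : ℕ, Matrix (Fin (arch (ℓ + 1))) (Fin (arch ℓ)) ℝ)
    (b : ∀ ℓ : ℕ, Fin (arch (ℓ + 1)) → ℝ) : ℝ :=
  (m : ℝ) ^ L * matInfNorm (A L) *
    ∏ s ∈ Finset.range L, (max (augInfNorm (A s) (b s)) 1) ^ (m ^ (L - s))

/-- The size `𝒮 = Σ_{s=0}^{L−1} d_{s+1}(d_s + 1)` of an architecture. -/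
def netSize (arch : ℕ → ℕ) (L : ℕ) : ℕ :=
  ∑ s ∈ Finset.range L, arch (s + 1) * (arch s + 1)

/-- The class `𝒩_K` of RePU networks of order `m`, depth `L`, fixed architecture `arch`,
with norm constraint `κ(θ) ≤ K`. -/
def NNclassArch (m L : ℕ) (arch : ℕ → ℕ) (K : ℝ) : Set ((Fin (arch 0) → ℝ) → ℝ) :=
  { g | ∃ A b, kappa m L arch A b ≤ K ∧ g = netOut m arch A b L }

/-- The points of `ℤ^ι` in an `ℓ¹`-ball of radius `|ι| / ε` number at most `(12 / ε)^|ι|`. -/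
lemma card_int_l1_ball_le {ι : Type*} [Fintype ι] [DecidableEq ι] {ε : ℝ} (hε : 0 < ε)
    (hε1 : ε ≤ 1) (N : ℕ) :
    (((Fintype.piFinset fun _ : ι => Finset.Icc (-(N : ℤ)) N).filter
      fun k => ε * ∑ j, |(k j : ℝ)| ≤ Fintype.card ι).card : ℝ) ≤
      (12 / ε) ^ Fintype.card ι := by
  have hgeom : ∑ k ∈ Finset.Icc (-(N : ℤ)) N, Real.exp (1 - ε * |(k : ℝ)|) ≤ 12 / ε := by
    have hz0 : 0 < Real.exp (-ε) := Real.exp_pos _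
    have hz1 : Real.exp (-ε) ≤ 1 - ε / 2 := by
      have h1 : ε + 1 ≤ Real.exp ε := Real.add_one_le_exp ε
      rw [Real.exp_neg, inv_le_iff_one_le_mul₀ (Real.exp_pos _)]
      nlinarith
    have hpow : ∀ k : ℕ, Real.exp (1 - ε * k) = Real.exp 1 * Real.exp (-ε) ^ k := by
      intro k
      rw [← Real.exp_nat_mul, ← Real.exp_add]
      ring_nf
    have hsub : Finset.Icc (-(N : ℤ)) N ⊆
        (Finset.range (N + 1)).image (fun k : ℕ => (k : ℤ)) ∪
          (Finset.range (N + 1)).image (fun k : ℕ => -(k : ℤ)) := by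
      intro k hk
      simp only [Finset.mem_Icc] at hk
      simp only [Finset.mem_union, Finset.mem_image, Finset.mem_range]
      rcases le_total 0 k with h | h
      · exact Or.inl ⟨k.toNat, by omega, by omega⟩
      · exact Or.inr ⟨(-k).toNat, by omega, by omega⟩
    have hhalf : ∑ k ∈ Finset.range (N + 1), Real.exp (1 - ε * k) ≤ 6 / ε := by
      simp_rw [hpow, ← Finset.mul_sum]
      have hs : ∑ k ∈ Finset.range (N + 1), Real.exp (-ε) ^ k ≤ 2 / ε := by
        have h2 := mul_neg_geom_sum (Real.exp (-ε)) (N + 1)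
        have h3 : 0 < Real.exp (-ε) ^ (N + 1) := by positivity
        have h4 : 0 ≤ ∑ k ∈ Finset.range (N + 1), Real.exp (-ε) ^ k := by positivity
        rw [le_div_iff₀ hε]
        nlinarith
      calc _ ≤ 3 * (2 / ε) := by
            gcongr
            exact Real.exp_one_lt_three.le
        _ = 6 / ε := by ring
    calc _ ≤ ∑ k ∈ (Finset.range (N + 1)).image (fun k : ℕ => (k : ℤ)) ∪
          (Finset.range (N + 1)).image (fun k : ℕ => -(k : ℤ)),
            Real.exp (1 - ε * |(k : ℝ)|) :=
          Finset.sum_le_sum_of_subset_of_nonneg hsub fun _ _ _ => (Real.exp_pos _).le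
      _ ≤ ∑ k ∈ (Finset.range (N + 1)).image (fun k : ℕ => (k : ℤ)),
            Real.exp (1 - ε * |(k : ℝ)|) +
          ∑ k ∈ (Finset.range (N + 1)).image (fun k : ℕ => -(k : ℤ)),
            Real.exp (1 - ε * |(k : ℝ)|) := by
          rw [← Finset.sum_union_inter]
          exact le_add_of_nonneg_right (Finset.sum_nonneg fun _ _ => (Real.exp_pos _).le)
      _ = ∑ k ∈ Finset.range (N + 1), Real.exp (1 - ε * k) +
          ∑ k ∈ Finset.range (N + 1), Real.exp (1 - ε * k) := by
          rw [Finset.sum_image (by intro a _ b _ h; simpa using h),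
            Finset.sum_image (by intro a _ b _ h; simpa using h)]
          simp
      _ ≤ 6 / ε + 6 / ε := add_le_add hhalf hhalf
      _ = 12 / ε := by ring
  calc _ = ∑ k ∈ (Fintype.piFinset fun _ : ι => Finset.Icc (-(N : ℤ)) N).filter
        fun k => ε * ∑ j, |(k j : ℝ)| ≤ Fintype.card ι, (1 : ℝ) := by simp
    _ ≤ ∑ k ∈ (Fintype.piFinset fun _ : ι => Finset.Icc (-(N : ℤ)) N).filter
        fun k => ε * ∑ j, |(k j : ℝ)| ≤ Fintype.card ι,
          ∏ j, Real.exp (1 - ε * |(k j : ℝ)|) := by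
        refine Finset.sum_le_sum fun k hk => ?_
        rw [← Real.exp_sum, Real.one_le_exp_iff, Finset.sum_sub_distrib, ← Finset.mul_sum]
        simpa using (Finset.mem_filter.1 hk).2
    _ ≤ ∑ k ∈ Fintype.piFinset fun _ : ι => Finset.Icc (-(N : ℤ)) N,
          ∏ j, Real.exp (1 - ε * |(k j : ℝ)|) :=
        Finset.sum_le_sum_of_subset_of_nonneg (Finset.filter_subset _ _) fun _ _ _ =>
          Finset.prod_nonneg fun _ _ => (Real.exp_pos _).le
    _ = (∑ k ∈ Finset.Icc (-(N : ℤ)) N, Real.exp (1 - ε * |(k : ℝ)|)) ^ Fintype.card ι := by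
        rw [← Finset.prod_univ_sum (fun _ => Finset.Icc (-(N : ℤ)) N)
          fun _ k => Real.exp (1 - ε * |(k : ℝ)|)]
        simp
    _ ≤ _ := by gcongr

/-- Rounding towards zero onto the grid `δ ℤ`. -/
lemma exists_int_round_toward_zero {δ : ℝ} (hδ : 0 < δ) (v : ℝ) :
    ∃ k : ℤ, δ * |(k : ℝ)| ≤ |v| ∧ |v - δ * k| ≤ δ := by
  have key : ∀ w : ℝ, 0 ≤ w → ∃ k : ℤ, δ * |(k : ℝ)| ≤ w ∧ |w - δ * k| ≤ δ := by
    intro w hw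
    have h0 : (0 : ℝ) ≤ (⌊w / δ⌋ : ℤ) := by exact_mod_cast Int.floor_nonneg.2 (by positivity)
    have h1 : δ * (⌊w / δ⌋ : ℤ) ≤ w := by
      have := Int.floor_le (w / δ)
      rwa [le_div_iff₀ hδ, mul_comm] at this
    have h2 : w ≤ δ * (⌊w / δ⌋ : ℤ) + δ := by
      have := (Int.lt_floor_add_one (w / δ)).le
      rw [div_le_iff₀ hδ] at this
      linarith
    refine ⟨⌊w / δ⌋, by rwa [abs_of_nonneg h0], ?_⟩
    rw [abs_le]
    constructor <;> linarith
  rcases le_total 0 v with hv | hv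
  · rw [abs_of_nonneg hv]
    exact key v hv
  · obtain ⟨k, hk1, hk2⟩ := key (-v) (by linarith)
    refine ⟨-k, by rw [abs_of_nonpos hv]; simpa using hk1, ?_⟩
    rw [← abs_neg]
    convert hk2 using 2
    push_cast
    ring

/-- The `ℓ¹` unit ball of `ℝ^ι` has an internal `ε`-net with at most `(12 / ε)^|ι|` elements. -/
lemma exists_l1_ball_net (ι : Type*) [Fintype ι] {ε : ℝ} (hε : 0 < ε) (hε1 : ε ≤ 1) :
    ∃ N : Finset (ι → ℝ), (N.card : ℝ) ≤ (12 / ε) ^ Fintype.card ι ∧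
      (∀ w ∈ N, ∑ j, |w j| ≤ 1) ∧
      ∀ v : ι → ℝ, ∑ j, |v j| ≤ 1 → ∃ w ∈ N, ∑ j, |v j - w j| ≤ ε := by
  classical
  rcases isEmpty_or_nonempty ι with hι | hι
  · exact ⟨{0}, by simp, by simp, fun v _ => ⟨0, by simp, by simpa using hε.le⟩⟩
  set n : ℝ := (Fintype.card ι : ℝ) with hn
  have hn0 : 0 < n := by
    rw [hn]
    exact_mod_cast Fintype.card_pos
  set δ := ε / n with hδ
  have hδ0 : 0 < δ := by positivity
  have hδn : ε = n * δ := by rw [hδ]; field_simp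
  refine ⟨((Fintype.piFinset fun _ : ι => Finset.Icc (-(⌈1 / δ⌉₊ : ℤ)) ⌈1 / δ⌉₊).filter
      fun k => ε * ∑ j, |(k j : ℝ)| ≤ Fintype.card ι).image fun k j => δ * (k j : ℝ),
    le_trans (by exact_mod_cast Finset.card_image_le) (card_int_l1_ball_le hε hε1 _), ?_, ?_⟩
  · intro w hw
    obtain ⟨k, hk, rfl⟩ := Finset.mem_image.1 hw
    have h := (Finset.mem_filter.1 hk).2
    simp_rw [abs_mul, abs_of_pos hδ0, ← Finset.mul_sum]
    rw [hδn, ← hn, mul_assoc] at h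
    exact le_of_mul_le_mul_left (by linarith) hn0
  · intro v hv
    choose k hk1 hk2 using fun j => exists_int_round_toward_zero hδ0 (v j)
    have hsum : δ * ∑ j, |(k j : ℝ)| ≤ 1 := by
      rw [Finset.mul_sum]
      exact (Finset.sum_le_sum fun j _ => hk1 j).trans hv
    refine ⟨fun j => δ * k j, Finset.mem_image.2 ⟨k, Finset.mem_filter.2 ⟨?_, ?_⟩, rfl⟩, ?_⟩
    · rw [Fintype.mem_piFinset]
      intro j
      have h1 : δ * |(k j : ℝ)| ≤ 1 := (mul_le_mul_of_nonneg_left (Finset.single_le_sum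
        (f := fun j => |(k j : ℝ)|) (fun _ _ => abs_nonneg _) (Finset.mem_univ j)) hδ0.le).trans
          hsum
      have h2 : |(k j : ℝ)| ≤ (⌈1 / δ⌉₊ : ℝ) := by
        refine le_trans ?_ (Nat.le_ceil _)
        rw [le_div_iff₀ hδ0]
        linarith
      rw [Finset.mem_Icc, ← abs_le]
      exact_mod_cast h2
    · rw [← hn, hδn, mul_assoc]
      nlinarith
    · calc _ ≤ ∑ _j : ι, δ := Finset.sum_le_sum fun j _ => hk2 j
        _ = ε := by rw [hδn]; simp [hn]

lemma abs_sum_mul_le_one {ι : Type*} [Fintype ι] {v p : ι → ℝ} (hv : ∑ j, |v j| ≤ 1)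
    (hp : ∀ j, |p j| ≤ 1) : |∑ j, v j * p j| ≤ 1 := by
  refine (Finset.abs_sum_le_sum_abs _ _).trans (le_trans (Finset.sum_le_sum fun j _ => ?_) hv)
  rw [abs_mul]
  exact mul_le_of_le_one_right (abs_nonneg _) (hp j)

lemma abs_sum_mul_sub_sum_mul_le {ι : Type*} [Fintype ι] {v w p q : ι → ℝ} {e ε : ℝ}
    (he : 0 ≤ e) (hv : ∑ j, |v j| ≤ 1) (hvw : ∑ j, |v j - w j| ≤ ε)
    (hpq : ∀ j, |p j - q j| ≤ e) (hq : ∀ j, |q j| ≤ 1) :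
    |∑ j, v j * p j - ∑ j, w j * q j| ≤ e + ε := by
  have hsplit : ∑ j, v j * p j - ∑ j, w j * q j =
      ∑ j, (v j * (p j - q j) + (v j - w j) * q j) := by
    rw [← Finset.sum_sub_distrib]
    exact Finset.sum_congr rfl fun j _ => by ring
  rw [hsplit]
  calc _ ≤ ∑ j, |v j * (p j - q j) + (v j - w j) * q j| := Finset.abs_sum_le_sum_abs _ _
    _ ≤ ∑ j, (|v j| * e + |v j - w j|) := by
        refine Finset.sum_le_sum fun j _ => (abs_add_le _ _).trans ?_
        rw [abs_mul, abs_mul]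
        exact add_le_add (mul_le_mul_of_nonneg_left (hpq j) (abs_nonneg _))
          (mul_le_of_le_one_right (abs_nonneg _) (hq j))
    _ = (∑ j, |v j|) * e + ∑ j, |v j - w j| := by
        rw [Finset.sum_add_distrib, Finset.sum_mul]
    _ ≤ e + ε := by nlinarith

lemma repu_mul {c : ℝ} (hc : 0 ≤ c) (m : ℕ) (t : ℝ) : repu m (c * t) = c ^ m * repu m t := by
  rw [repu, repu, ← mul_pow, mul_max_of_nonneg _ _ hc, mul_zero]

lemma abs_max_zero_le_one {t : ℝ} (ht : |t| ≤ 1) : |max t 0| ≤ 1 := by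
  rw [abs_of_nonneg (le_max_right _ _)]
  exact max_le ((le_abs_self t).trans ht) zero_le_one

lemma abs_repu_le_one (m : ℕ) {t : ℝ} (ht : |t| ≤ 1) : |repu m t| ≤ 1 := by
  rw [repu, abs_pow]
  exact pow_le_one₀ (abs_nonneg _) (abs_max_zero_le_one ht)

lemma abs_repu_sub_repu_le (m : ℕ) {s t : ℝ} (hs : |s| ≤ 1) (ht : |t| ≤ 1) :
    |repu m s - repu m t| ≤ m * |s - t| := by
  have h1 : |max s 0 - max t 0| ≤ |s - t| := abs_max_sub_max_le_abs s t 0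
  have h2 : max |max s 0| |max t 0| ^ (m - 1) ≤ 1 :=
    pow_le_one₀ (le_max_of_le_left (abs_nonneg _))
      (max_le (abs_max_zero_le_one hs) (abs_max_zero_le_one ht))
  calc _ ≤ |max s 0 - max t 0| * m * max |max s 0| |max t 0| ^ (m - 1) :=
        abs_pow_sub_pow_le _ _ _
    _ ≤ |s - t| * m * 1 := by gcongr
    _ = _ := by ring

/-- The row `v` with an appended bias coordinate. -/
def biasRow {n : ℕ} (v : Fin n → ℝ) (β : ℝ) (o : Option (Fin n)) : ℝ := o.elim β v

/-- The product of the layer norms controlling the size of the `ℓ`-th hidden layer. -/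
noncomputable def layerScale (m : ℕ) (arch : ℕ → ℕ)
    (A : ∀ ℓ : ℕ, Matrix (Fin (arch (ℓ + 1))) (Fin (arch ℓ)) ℝ)
    (b : ∀ ℓ : ℕ, Fin (arch (ℓ + 1)) → ℝ) (ℓ : ℕ) : ℝ :=
  ∏ s ∈ Finset.range ℓ, (max (augInfNorm (A s) (b s)) 1) ^ (m ^ (ℓ - s))

section Network

variable (m : ℕ) (arch : ℕ → ℕ) (A : ∀ ℓ : ℕ, Matrix (Fin (arch (ℓ + 1))) (Fin (arch ℓ)) ℝ)
  (b : ∀ ℓ : ℕ, Fin (arch (ℓ + 1)) → ℝ)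

lemma one_le_layerScale (ℓ : ℕ) : 1 ≤ layerScale m arch A b ℓ :=
  Finset.one_le_prod fun _ _ => one_le_pow₀ (le_max_right _ _)

lemma layerScale_succ (ℓ : ℕ) : layerScale m arch A b (ℓ + 1) =
    (max (augInfNorm (A ℓ) (b ℓ)) 1 * layerScale m arch A b ℓ) ^ m := by
  rw [layerScale, layerScale, Finset.prod_range_succ, mul_pow, ← Finset.prod_pow, mul_comm]
  congr 1
  · simp
  · refine Finset.prod_congr rfl fun s hs => ?_
    rw [← pow_mul, ← pow_succ, Nat.succ_sub (Finset.mem_range.1 hs).le]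

/-- The `i`-th augmented row of layer `ℓ`, normalized to lie in the `ℓ¹` unit ball. -/
noncomputable def normalizedRow (ℓ : ℕ) (i : Fin (arch (ℓ + 1))) : Option (Fin (arch ℓ)) → ℝ :=
  biasRow (fun j => A ℓ i j / max (augInfNorm (A ℓ) (b ℓ)) 1)
    (b ℓ i / (max (augInfNorm (A ℓ) (b ℓ)) 1 * layerScale m arch A b ℓ))

lemma sum_abs_normalizedRow_le_one (ℓ : ℕ) (i : Fin (arch (ℓ + 1))) :
    ∑ o, |normalizedRow m arch A b ℓ i o| ≤ 1 := by
  set M := max (augInfNorm (A ℓ) (b ℓ)) 1 with hM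
  have hM1 : 1 ≤ M := le_max_right _ _
  have hM0 : 0 < M := by linarith
  have hc := one_le_layerScale m arch A b ℓ
  have hrow : (∑ j, |A ℓ i j|) + |b ℓ i| ≤ M :=
    (le_ciSup (f := fun i => (∑ j, |A ℓ i j|) + |b ℓ i|) (Set.finite_range _).bddAbove i).trans
      (le_max_left _ _)
  rw [Fintype.sum_option]
  simp only [normalizedRow, biasRow, Option.elim, ← hM, abs_div, ← Finset.sum_div]
  rw [abs_of_pos hM0, abs_of_pos (by positivity : 0 < M * layerScale m arch A b ℓ)]
  calc _ ≤ |b ℓ i| / M + (∑ j, |A ℓ i j|) / M := by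
        gcongr
        exact le_mul_of_one_le_right hM0.le hc
    _ ≤ 1 := by
        rw [← add_div, div_le_one hM0]
        linarith

lemma netFwd_succ_div (x : Fin (arch 0) → ℝ) (ℓ : ℕ) (i : Fin (arch (ℓ + 1))) :
    netFwd m arch A b x (ℓ + 1) i / layerScale m arch A b (ℓ + 1) =
      repu m (∑ o, normalizedRow m arch A b ℓ i o *
        biasRow (fun j => netFwd m arch A b x ℓ j / layerScale m arch A b ℓ) 1 o) := by
  have hM0 : 0 < max (augInfNorm (A ℓ) (b ℓ)) 1 := lt_max_of_lt_right one_pos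
  have hc : 0 < layerScale m arch A b ℓ := one_pos.trans_le (one_le_layerScale m arch A b ℓ)
  rw [div_eq_iff (one_pos.trans_le (one_le_layerScale m arch A b _)).ne', layerScale_succ,
    mul_comm, ← repu_mul (by positivity)]
  simp only [netFwd, Fintype.sum_option, normalizedRow, biasRow, Option.elim, Matrix.mulVec,
    dotProduct]
  congr 1
  rw [mul_add, Finset.mul_sum, add_comm]
  congr 1
  · field_simp
  · refine Finset.sum_congr rfl fun j _ => ?_
    field_simp

variable {m arch}

lemma abs_biasRow_le_one {n : ℕ} {p : Fin n → ℝ} (hp : ∀ j, |p j| ≤ 1) (o : Option (Fin n)) :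
    |biasRow p 1 o| ≤ 1 := by
  cases o with
  | none => simp [biasRow]
  | some j => exact hp j

lemma abs_netFwd_div_le_one {x : Fin (arch 0) → ℝ} (hx : x ∈ Set.Icc 0 1) (ℓ : ℕ)
    (i : Fin (arch ℓ)) : |netFwd m arch A b x ℓ i / layerScale m arch A b ℓ| ≤ 1 := by
  induction ℓ with
  | zero =>
    simp only [netFwd, layerScale, Finset.range_zero, Finset.prod_empty, div_one]
    have h0 : 0 ≤ x i := hx.1 i
    rw [abs_of_nonneg h0]
    exact hx.2 i
  | succ ℓ ih =>
    rw [netFwd_succ_div]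
    exact abs_repu_le_one m (abs_sum_mul_le_one (sum_abs_normalizedRow_le_one m arch A b ℓ i)
      (abs_biasRow_le_one ih))

end Network

/-- Covering of the normalized hidden layers. -/
lemma exists_hiddenLayer_net {m : ℕ} (hm : 2 ≤ m) (arch : ℕ → ℕ) {ε : ℝ} (hε : 0 < ε)
    (hε1 : ε ≤ 1) (ℓ : ℕ) :
    ∃ T : Finset ((Fin (arch 0) → ℝ) → Fin (arch ℓ) → ℝ),
      (T.card : ℝ) ≤ (12 / ε) ^ netSize arch ℓ ∧
      (∀ t ∈ T, ∀ x ∈ Set.Icc (0 : Fin (arch 0) → ℝ) 1, ∀ i, |t x i| ≤ 1) ∧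
      ∀ A b, ∃ t ∈ T, ∀ x ∈ Set.Icc (0 : Fin (arch 0) → ℝ) 1, ∀ i,
        |netFwd m arch A b x ℓ i / layerScale m arch A b ℓ - t x i| ≤
          2 * ε * ((m : ℝ) ^ ℓ - 1) := by
  classical
  have hm2 : (2 : ℝ) ≤ m := by exact_mod_cast hm
  induction ℓ with
  | zero =>
    refine ⟨{id}, by simp [netSize], ?_, fun A b => ⟨id, by simp, fun x _ i => ?_⟩⟩
    · intro t ht x hx i
      rw [Finset.mem_singleton.1 ht, id, abs_of_nonneg (hx.1 i)]
      exact hx.2 i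
    · simp [netFwd, layerScale]
  | succ ℓ ih =>
    obtain ⟨T, hTcard, hT1, hT⟩ := ih
    obtain ⟨N, hNcard, hN1, hN⟩ := exists_l1_ball_net (Option (Fin (arch ℓ))) hε hε1
    refine ⟨Finset.image₂ (fun t (R : Fin (arch (ℓ + 1)) → Option (Fin (arch ℓ)) → ℝ) x i =>
        repu m (∑ o, R i o * biasRow (t x) 1 o)) T
      (Fintype.piFinset fun _ : Fin (arch (ℓ + 1)) => N), ?_, ?_, ?_⟩
    · calc _ ≤ (T.card : ℝ) * (Fintype.piFinset fun _ : Fin (arch (ℓ + 1)) => N).card := by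
            rw [← Nat.cast_mul]
            exact Nat.cast_le.2 (Finset.card_image₂_le _ _ _)
        _ = (T.card : ℝ) * (N.card : ℝ) ^ arch (ℓ + 1) := by simp
        _ ≤ (12 / ε) ^ netSize arch ℓ *
            ((12 / ε) ^ Fintype.card (Option (Fin (arch ℓ)))) ^ arch (ℓ + 1) := by gcongr
        _ = (12 / ε) ^ netSize arch (ℓ + 1) := by
            rw [← pow_mul, ← pow_add, netSize, netSize, Finset.sum_range_succ]
            simp [mul_comm]
    · intro f hf x hx i
      obtain ⟨t, ht, R, hR, rfl⟩ := Finset.mem_image₂.1 hf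
      exact abs_repu_le_one m (abs_sum_mul_le_one (hN1 _ (Fintype.mem_piFinset.1 hR i))
        (abs_biasRow_le_one (hT1 t ht x hx)))
    · intro A b
      obtain ⟨t, ht, htx⟩ := hT A b
      choose R hR hRv using fun i => hN _ (sum_abs_normalizedRow_le_one m arch A b ℓ i)
      refine ⟨_, Finset.mem_image₂_of_mem ht (Fintype.mem_piFinset.2 hR), fun x hx i => ?_⟩
      have he : 0 ≤ 2 * ε * ((m : ℝ) ^ ℓ - 1) :=
        mul_nonneg (by positivity) (sub_nonneg.2 (one_le_pow₀ (by linarith)))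
      rw [netFwd_succ_div]
      have hpre := abs_sum_mul_sub_sum_mul_le (q := biasRow (t x) 1)
        (p := biasRow (fun j => netFwd m arch A b x ℓ j / layerScale m arch A b ℓ) 1) he
        (sum_abs_normalizedRow_le_one m arch A b ℓ i) (hRv i)
        (fun o => by
          cases o with
          | none => simpa [biasRow] using he
          | some j => exact htx x hx j)
        (abs_biasRow_le_one (hT1 t ht x hx))
      refine (abs_repu_sub_repu_le m
        (abs_sum_mul_le_one (sum_abs_normalizedRow_le_one m arch A b ℓ i)
          (abs_biasRow_le_one (abs_netFwd_div_le_one A b hx ℓ)))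
        (abs_sum_mul_le_one (hN1 _ (hR i)) (abs_biasRow_le_one (hT1 t ht x hx)))).trans
        ((mul_le_mul_of_nonneg_left hpre (by positivity)).trans ?_)
      rw [pow_succ]
      nlinarith

/-- A norm-constrained network is `K / m ^ L` times an `ℓ¹`-contractive combination of the
normalized last hidden layer. -/
lemma exists_netOut_eq {m L : ℕ} (hm : 0 < m) {arch : ℕ → ℕ} (hL : arch (L + 1) = 1) {K : ℝ}
    (hK : 0 < K) {A : ∀ ℓ : ℕ, Matrix (Fin (arch (ℓ + 1))) (Fin (arch ℓ)) ℝ}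
    {b : ∀ ℓ : ℕ, Fin (arch (ℓ + 1)) → ℝ} (hκ : kappa m L arch A b ≤ K) :
    ∃ v : Fin (arch L) → ℝ, ∑ j, |v j| ≤ 1 ∧ ∀ x, netOut m arch A b L x =
      K / (m : ℝ) ^ L *
        ∑ j, v j * (netFwd m arch A b x L j / layerScale m arch A b L) := by
  have hc : 0 < layerScale m arch A b L := one_pos.trans_le (one_le_layerScale m arch A b L)
  have hm0 : (0 : ℝ) < (m : ℝ) ^ L := by positivity
  let i₀ : Fin (arch (L + 1)) := ⟨0, by omega⟩
  have huniv : (Finset.univ : Finset (Fin (arch (L + 1)))) = {i₀} := by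
    ext i
    simp only [Finset.mem_univ, Finset.mem_singleton, true_iff]
    ext
    simp only [i₀]
    omega
  have hrow : ∑ j, |A L i₀ j| ≤ matInfNorm (A L) :=
    le_ciSup (f := fun i => ∑ j, |A L i j|) (Set.finite_range _).bddAbove i₀
  have hfac : 0 < (m : ℝ) ^ L * layerScale m arch A b L / K := by positivity
  refine ⟨fun j => (m : ℝ) ^ L * layerScale m arch A b L / K * A L i₀ j, ?_, fun x => ?_⟩
  · simp_rw [abs_mul, ← Finset.mul_sum, abs_of_pos hfac]
    calc _ ≤ (m : ℝ) ^ L * layerScale m arch A b L / K * matInfNorm (A L) := by gcongr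
      _ = kappa m L arch A b / K := by
          rw [kappa, layerScale]
          ring
      _ ≤ 1 := (div_le_one hK).2 hκ
  · rw [netOut, huniv, Finset.sum_singleton, Matrix.mulVec, dotProduct, Finset.mul_sum]
    refine Finset.sum_congr rfl fun j _ => ?_
    field_simp

lemma arch_le_netSize (arch : ℕ → ℕ) {L : ℕ} (hL : 1 ≤ L) : arch L ≤ netSize arch L := by
  obtain ⟨ℓ, rfl⟩ := Nat.exists_eq_add_of_le' hL
  rw [netSize, Finset.sum_range_succ]
  exact (Nat.le_mul_of_pos_right _ (Nat.succ_pos _)).trans (Nat.le_add_left _ _)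

/-- Sup-norm covering bound for norm-constrained RePU networks: there is
an absolute constant `C > 0` such that for every architecture and every `K, u > 0` the
class `𝒩_K` restricted to `[0,1]^d` has a `u`-cover of cardinality at most
`exp(C · 𝒮 · log(1 + K/u))`. -/
theorem stmt5 :
    ∃ C : ℝ, 0 < C ∧
      ∀ (d m L : ℕ), 0 < d → 2 ≤ m → 1 ≤ L →
      ∀ arch : ℕ → ℕ, arch 0 = d → arch (L + 1) = 1 →
      ∀ K u : ℝ, 0 < K → 0 < u →
      ∃ T : Finset ((Fin (arch 0) → ℝ) → ℝ),
        (T.card : ℝ) ≤ Real.exp (C * (netSize arch L : ℝ) * Real.log (1 + K / u)) ∧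
        ∀ g ∈ NNclassArch m L arch K, ∃ g' ∈ T,
          ∀ x ∈ Set.Icc (0 : Fin (arch 0) → ℝ) 1, |g x - g' x| ≤ u := by
  classical
  refine ⟨12, by norm_num, ?_⟩
  intro d m L _ hm hL arch _ hout K u hK hu
  have hm0 : 0 < m := by omega
  have hmL : (1 : ℝ) ≤ (m : ℝ) ^ L := one_le_pow₀ (by exact_mod_cast hm0)
  have hmL0 : (0 : ℝ) < (m : ℝ) ^ L := by positivity
  rcases le_total K u with hKu | hKu
  · refine ⟨{0}, ?_, ?_⟩
    · rw [Finset.card_singleton, Nat.cast_one]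
      have hlog : 0 ≤ Real.log (1 + K / u) :=
        Real.log_nonneg (le_add_of_nonneg_right (by positivity))
      exact Real.one_le_exp (by positivity)
    · rintro g ⟨A, b, hκ, rfl⟩
      obtain ⟨v, hv, hg⟩ := exists_netOut_eq hm0 hout hK hκ
      refine ⟨0, by simp, fun x hx => ?_⟩
      rw [Pi.zero_apply, sub_zero, hg, abs_mul, abs_of_pos (by positivity)]
      calc _ ≤ K / (m : ℝ) ^ L * 1 := by
            gcongr
            exact abs_sum_mul_le_one hv (abs_netFwd_div_le_one A b hx L)
        _ ≤ u := by
            rw [mul_one]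
            exact (div_le_self hK.le hmL).trans hKu
  · set ε := u / (2 * K) with hεdef
    have hε : 0 < ε := by positivity
    have hε1 : ε ≤ 1 := by
      rw [hεdef, div_le_one (by positivity)]
      linarith
    obtain ⟨T, hTcard, hT1, hT⟩ := exists_hiddenLayer_net hm arch hε hε1 L
    obtain ⟨N, hNcard, -, hN⟩ := exists_l1_ball_net (Fin (arch L)) hε hε1
    refine ⟨Finset.image₂ (fun t w x => K / (m : ℝ) ^ L * ∑ j, w j * t x j) T N, ?_, ?_⟩
    · have hy : 1 ≤ K / u := (one_le_div hu).2 hKu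
      have hbase : 12 / ε ≤ (1 + K / u) ^ 6 := by
        have h1 : 12 / ε = 24 * (K / u) := by
          rw [hεdef]
          field_simp
          norm_num
        have h2 : (2 : ℝ) ^ 5 ≤ (1 + K / u) ^ 5 := by
          gcongr
          linarith
        rw [h1, pow_succ]
        nlinarith
      have h1ε : 1 ≤ 12 / ε := by
        rw [one_le_div hε]
        linarith
      calc _ ≤ (T.card : ℝ) * N.card := by
            rw [← Nat.cast_mul]
            exact Nat.cast_le.2 (Finset.card_image₂_le _ _ _)
        _ ≤ (12 / ε) ^ netSize arch L * (12 / ε) ^ Fintype.card (Fin (arch L)) := by gcongr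
        _ ≤ (12 / ε) ^ netSize arch L * (12 / ε) ^ netSize arch L := by
            gcongr
            simpa using arch_le_netSize arch hL
        _ ≤ ((1 + K / u) ^ 6) ^ netSize arch L * ((1 + K / u) ^ 6) ^ netSize arch L := by
            gcongr
        _ = (1 + K / u) ^ (12 * netSize arch L) := by
            rw [← pow_mul, ← pow_add]
            ring_nf
        _ = _ := by
            rw [← Real.exp_log (by positivity : 0 < 1 + K / u), ← Real.exp_nat_mul,
              Real.log_exp]
            push_cast
            ring_nf
    · rintro g ⟨A, b, hκ, rfl⟩
      obtain ⟨v, hv, hg⟩ := exists_netOut_eq hm0 hout hK hκ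
      obtain ⟨t, ht, htx⟩ := hT A b
      obtain ⟨w, hw, hvw⟩ := hN v hv
      refine ⟨_, Finset.mem_image₂_of_mem ht hw, fun x hx => ?_⟩
      have he : 0 ≤ 2 * ε * ((m : ℝ) ^ L - 1) :=
        mul_nonneg (by positivity) (sub_nonneg.2 hmL)
      have hdiff := abs_sum_mul_sub_sum_mul_le he hv hvw (htx x hx) (hT1 t ht x hx)
      rw [hg, ← mul_sub, abs_mul, abs_of_pos (by positivity : 0 < K / (m : ℝ) ^ L)]
      calc _ ≤ K / (m : ℝ) ^ L * (2 * ε * (m : ℝ) ^ L) := by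
            gcongr
            linarith
        _ = u := by
            rw [hεdef]
            field_simp
end

section
/- There exist absolute constants b₁, b₂ > 0 with the following property. Let ℓ : ℝ → ℝ be Lipschitz with constant ‖ℓ‖_Lip, let P be a Borel probability measure on 𝒳 × ℝ with 𝒳 ⊆ ℝ^d and X-marginal P_X, and let (X₁, Y₁), …, (X_n, Y_n) be i.i.d. with law P. Let M > 0, let F be a countable class of measurable functions on 𝒳 with sup_{f ∈ F} ‖f‖_∞ ≤ M, let f₀ be measurable with ‖f₀‖_∞ ≤ M, and set F* = { a(f − f₀) : a ∈ [0,1], f ∈ F }, ‖g‖₂ = (∫ g² dP_X)^{1/2}, and H_n(f) = E_P[ℓ(f(X)−Y) − ℓ(f₀(X)−Y)] − n^{−1} Σ_{i=1}^n [ℓ(f(X_i)−Y_i) − ℓ(f₀(X_i)−Y_i)]. Suppose r ∈ (0, M/3] satisfies E[ R̄_n(r; F*) ] = r²/(64M), where R̄_n(r; F*) is the localized Rademacher complexity computed at the data points X₁, …, X_n and the outer expectation is over the sample. Then with probability at least 1 − 2·exp( −b₁·n·r²/(2M²) + b₂·log(log(M/r)) ), every f ∈ F satisfies |H_n(f)|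 ≤ 2·‖ℓ‖_Lip·M^{−1}·r·( ‖f − f₀‖₂ + r ). -/
open MeasureTheory
open scoped ENNReal

/-- Localized Rademacher complexity at radius `r` (supremum taken in `[0,∞]`). -/
noncomputable def locRad {α : Type*} [MeasurableSpace α] (ν : Measure α)
    (G : Set (α → ℝ)) {n : ℕ} (x : Fin n → α) (r : ℝ) : ℝ≥0∞ :=
  (∑ ε : Fin n → Bool,
      ⨆ g ∈ { g ∈ G | Real.sqrt (∫ a, g a ^ 2 ∂ν) ≤ r },
        ENNReal.ofReal |(n : ℝ)⁻¹ * ∑ i, (if ε i then (1 : ℝ) else -1) * g (x i)|)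
    / 2 ^ n

section InfimumConvolution

/-- The minimum over `θ ∈ [0,1]` of `(1 - θ) * a + θ * b + θ ^ 2 / 8`. -/
noncomputable def quadMin (a b : ℝ) : ℝ :=
  (1 - max 0 (min 1 (4 * (a - b)))) * a + max 0 (min 1 (4 * (a - b))) * b
    + max 0 (min 1 (4 * (a - b))) ^ 2 / 8

lemma measurable_quadMin {α : Type*} [MeasurableSpace α] {f g : α → ℝ} (hf : Measurable f)
    (hg : Measurable g) : Measurable fun x => quadMin (f x) (g x) := by
  unfold quadMin; fun_prop

lemma quadMin_le (a b s : ℝ) (hs0 : 0 ≤ s) (hs1 : s ≤ 1) :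
    quadMin a b ≤ (1 - s) * a + s * b + s ^ 2 / 8 := by
  unfold quadMin
  rcases le_total (4 * (a - b)) 0 with h | h
  · rw [min_eq_right (by linarith), max_eq_left h]
    nlinarith
  · rcases le_total 1 (4 * (a - b)) with h1 | h1
    · rw [min_eq_left h1, max_eq_right zero_le_one]
      nlinarith
    · rw [min_eq_right h1, max_eq_right h]
      nlinarith [sq_nonneg (s - 4 * (a - b))]

lemma le_quadMin {a b u α : ℝ} (ha : u + 2 * α ^ 2 ≤ a) (hb : u + 2 * α ^ 2 ≤ b + α) :
    u ≤ quadMin a b := by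
  unfold quadMin
  have h0 : 0 ≤ max 0 (min 1 (4 * (a - b))) := le_max_left _ _
  have h1 : max 0 (min 1 (4 * (a - b))) ≤ 1 := max_le zero_le_one (min_le_left _ _)
  generalize max 0 (min 1 (4 * (a - b))) = θ at h0 h1
  nlinarith [mul_nonneg (sub_nonneg.2 h1) (sub_nonneg.2 ha), mul_nonneg h0 (sub_nonneg.2 hb),
    sq_nonneg (4 * α - θ)]

/-- A quadratic infimum-convolution of `V` along replacements of coordinates by the values `o k`. -/
noncomputable def infConv {Ω κ : Type*} (o : κ → Ω) :
    (n : ℕ) → ((Fin n → Ω) → ℝ) → (Fin n → Ω) → ℝ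
  | 0, V, x => V x
  | n + 1, V, x => ⨅ k, quadMin (infConv o n (fun y => V (Fin.cons (x 0) y)) (Fin.tail x))
      (infConv o n (fun y => V (Fin.cons (o k) y)) (Fin.tail x))

lemma measurable_fin_cons {Λ Ω : Type*} [MeasurableSpace Λ] [MeasurableSpace Ω] {n : ℕ} {f : Λ → Ω}
    {g : Λ → Fin n → Ω} (hf : Measurable f) (hg : Measurable g) :
    Measurable fun l => (Fin.cons (f l) (g l) : Fin (n + 1) → Ω) := by
  refine measurable_pi_lambda _ fun i => ?_
  refine Fin.cases ?_ (fun j => ?_) i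
  · simpa using hf
  · simpa using measurable_pi_iff.1 hg j

lemma measurable_infConv_param.{u, v} {Ω : Type u} {κ : Type v} [MeasurableSpace Ω] [Finite κ]
    (o : κ → Ω) (n : ℕ) :
    ∀ {Λ : Type u} [MeasurableSpace Λ] (V : Λ → (Fin n → Ω) → ℝ)
      (_ : Measurable fun q : Λ × (Fin n → Ω) => V q.1 q.2),
      Measurable fun q : Λ × (Fin n → Ω) => infConv o n (V q.1) q.2 := by
  induction n with
  | zero => intro Λ _ V hV; simpa [infConv] using hV
  | succ n ih =>
    intro Λ _ V hV
    simp only [infConv]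
    refine Measurable.iInf fun k => measurable_quadMin ?_ ?_
    · have h := ih (Λ := Λ × Ω) (fun l y => V l.1 (Fin.cons l.2 y))
        (hV.comp (Measurable.prodMk (by fun_prop)
          (measurable_fin_cons (measurable_snd.comp measurable_fst) measurable_snd)))
      refine h.comp (f := fun q : Λ × (Fin (n + 1) → Ω) => ((q.1, q.2 0), Fin.tail q.2)) ?_
      unfold Fin.tail
      fun_prop
    · have h := ih (Λ := Λ) (fun l y => V l (Fin.cons (o k) y))
        (hV.comp (Measurable.prodMk (by fun_prop)
          (measurable_fin_cons measurable_const measurable_snd)))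
      refine h.comp (f := fun q : Λ × (Fin (n + 1) → Ω) => (q.1, Fin.tail q.2)) ?_
      unfold Fin.tail
      fun_prop

lemma measurable_infConv {Ω κ : Type*} [MeasurableSpace Ω] [Finite κ] (o : κ → Ω) (n : ℕ)
    {V : (Fin n → Ω) → ℝ}
    (hV : Measurable V) : Measurable (infConv o n V) :=
  (measurable_infConv_param o n (Λ := PUnit) (fun _ => V) (hV.comp measurable_snd)).comp
    (f := fun x => (PUnit.unit, x)) (by fun_prop)

lemma le_infConv {Ω κ : Type*} [Finite κ] [Nonempty κ] (o : κ → Ω) (n : ℕ) :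
    ∀ (V : (Fin n → Ω) → ℝ) (x : Fin n → Ω) (u : ℝ) (α : Fin n → ℝ)
      (_ : ∀ (S : Fin n → Bool) (y : Fin n → Ω), (∀ i, S i = true → y i = x i) →
        (∀ i, S i = false → ∃ k, y i = o k) →
        u + 2 * ∑ i, α i ^ 2 ≤ V y + ∑ i, if S i then 0 else α i),
      u ≤ infConv o n V x := by
  induction n with
  | zero =>
    intro V x u α h
    simpa [infConv] using h (fun _ => true) x (by simp) (by simp)
  | succ n ih =>
    intro V x u α h
    refine le_ciInf fun k => le_quadMin (α := α 0) ?_ ?_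
    · refine ih _ _ _ (fun i => α i.succ) fun S y hy1 hy2 => ?_
      have := h (Fin.cons true S) (Fin.cons (x 0) y)
        (Fin.cases (by simp) fun i => by simpa [Fin.tail] using hy1 i)
        (Fin.cases (by simp) fun i => by simpa using hy2 i)
      simp only [Fin.sum_univ_succ, Fin.cons_zero, Fin.cons_succ, if_true] at this
      linarith
    · rw [← sub_le_iff_le_add]
      refine ih _ _ _ (fun i => α i.succ) fun S y hy1 hy2 => ?_
      have := h (Fin.cons false S) (Fin.cons (o k) y)
        (Fin.cases (by simp) fun i => by simpa [Fin.tail] using hy1 i)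
        (Fin.cases (by simp) fun i => by simpa using hy2 i)
      simp only [Fin.sum_univ_succ, Fin.cons_zero, Fin.cons_succ, Bool.false_eq_true,
        if_false] at this
      linarith

lemma exists_exp_add_exp_le (L : ℝ) (hL : 0 ≤ L) :
    ∃ θ : ℝ, 0 ≤ θ ∧ θ ≤ 1 ∧ Real.exp (θ ^ 2 / 8 + (1 - θ) * L) + Real.exp (-L) ≤ 2 := by
  have key : ∀ x : ℝ, |x| ≤ 1 → Real.exp x ≤ 1 + x + x ^ 2 := fun x hx => by
    have := (abs_le.1 (Real.abs_exp_sub_one_sub_id_le hx)).2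
    linarith
  rcases le_total L (1 / 4) with h | h
  · refine ⟨4 * L, by linarith, by linarith, ?_⟩
    have h1 := key ((4 * L) ^ 2 / 8 + (1 - 4 * L) * L) (abs_le.2 ⟨by nlinarith, by nlinarith⟩)
    have h2 := key (-L) (abs_le.2 ⟨by linarith, by linarith⟩)
    have h3 : (1 - 2 * L) ^ 2 ≤ 1 := by nlinarith
    nlinarith [mul_le_mul_of_nonneg_left h3 (sq_nonneg L)]
  · refine ⟨1, by norm_num, le_rfl, ?_⟩
    have h1 := key (1 / 8) (abs_le.2 ⟨by norm_num, by norm_num⟩)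
    have h2 := key (-(1 / 4)) (abs_le.2 ⟨by norm_num, by norm_num⟩)
    have h3 : Real.exp (-L) ≤ Real.exp (-(1 / 4)) := Real.exp_le_exp.2 (by linarith)
    have h4 : ((1 : ℝ) ^ 2 / 8 + (1 - 1) * L) = 1 / 8 := by ring
    rw [h4]
    linarith

lemma exists_interpolation_le {p q : ℝ} (hp : 0 < p) (hpq : p ≤ q) :
    ∃ θ : ℝ, 0 ≤ θ ∧ θ ≤ 1 ∧
      Real.exp (θ ^ 2 / 8) * (p⁻¹ ^ (1 - θ) * q⁻¹ ^ θ) + p / q ^ 2 ≤ 2 / q := by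
  have hq : 0 < q := hp.trans_le hpq
  obtain ⟨θ, h0, h1, h⟩ := exists_exp_add_exp_le (Real.log q - Real.log p)
    (sub_nonneg.2 (Real.log_le_log hp hpq))
  refine ⟨θ, h0, h1, ?_⟩
  have e1 : Real.exp (θ ^ 2 / 8) * (p⁻¹ ^ (1 - θ) * q⁻¹ ^ θ)
      = q⁻¹ * Real.exp (θ ^ 2 / 8 + (1 - θ) * (Real.log q - Real.log p)) := by
    rw [Real.rpow_def_of_pos (inv_pos.2 hp), Real.rpow_def_of_pos (inv_pos.2 hq), Real.log_inv,
      Real.log_inv, ← Real.exp_add, ← Real.exp_add]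
    have : q⁻¹ = Real.exp (-Real.log q) := by rw [Real.exp_neg, Real.exp_log hq]
    rw [this, ← Real.exp_add]
    congr 1; ring
  have e2 : p / q ^ 2 = q⁻¹ * Real.exp (-(Real.log q - Real.log p)) := by
    rw [neg_sub, Real.exp_sub, Real.exp_log hp, Real.exp_log hq]
    field_simp
  rw [e1, e2, ← mul_add, div_eq_mul_inv 2 q, mul_comm 2]
  exact mul_le_mul_of_nonneg_left h (inv_pos.2 hq).le

lemma measurable_ofReal_exp {Ω : Type*} [MeasurableSpace Ω] {f : Ω → ℝ} (hf : Measurable f) :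
    Measurable fun x => ENNReal.ofReal (Real.exp (f x)) := by
  fun_prop

lemma lintegral_pi_succ {Ω : Type*} [MeasurableSpace Ω] (P : Measure Ω) [SigmaFinite P] (n : ℕ)
    {f : (Fin (n + 1) → Ω) → ℝ≥0∞}
    (hf : Measurable f) :
    ∫⁻ x, f x ∂(Measure.pi fun _ : Fin (n + 1) => P)
      = ∫⁻ w, ∫⁻ y, f (Fin.cons w y) ∂(Measure.pi fun _ : Fin n => P) ∂P := by
  have h := (measurePreserving_piFinSuccAbove (fun _ : Fin (n + 1) => P) 0).symm
  rw [← h.lintegral_comp hf, lintegral_prod]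
  · simp [MeasurableEquiv.piFinSuccAbove, Fin.insertNthEquiv]
  · exact (hf.comp (MeasurableEquiv.measurable _)).aemeasurable

theorem lintegral_exp_infConv_mul_le {Ω κ : Type*} [MeasurableSpace Ω] (P : Measure Ω)
    [IsProbabilityMeasure P] [Finite κ]
    [Nonempty κ] (o : κ → Ω) (n : ℕ) :
    ∀ (V : (Fin n → Ω) → ℝ) (_ : Measurable V) (_ : ∀ x, 0 ≤ V x)
      (_ : (∀ w, ∃ k, o k = w) ∨ ∀ i x k, V (Function.update x i (o k)) ≤ V x),
      (∫⁻ x, ENNReal.ofReal (Real.exp (infConv o n V x)) ∂(Measure.pi fun _ : Fin n => P))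
        * (∫⁻ x, ENNReal.ofReal (Real.exp (-V x)) ∂(Measure.pi fun _ : Fin n => P)) ≤ 1 := by
  induction n with
  | zero =>
    intro V hV _ _
    have : ∀ x, V x = V default := fun x => by rw [Subsingleton.elim x default]
    simp only [infConv, this, lintegral_const, measure_univ, mul_one]
    rw [← ENNReal.ofReal_mul (Real.exp_pos _).le, ← Real.exp_add]
    simp
  | succ n ih =>
    intro V hV hV0 hmon
    set μ := Measure.pi fun _ : Fin n => P
    have hVc : ∀ w, Measurable fun y : Fin n → Ω => V (Fin.cons w y) := fun w =>
      hV.comp (measurable_fin_cons measurable_const measurable_id)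
    have hcons : Measurable fun q : Ω × (Fin n → Ω) => (Fin.cons q.1 q.2 : Fin (n + 1) → Ω) :=
      measurable_fin_cons measurable_fst measurable_snd
    set p : Ω → ℝ≥0∞ := fun w => ∫⁻ y, ENNReal.ofReal (Real.exp (-V (Fin.cons w y))) ∂μ with hp
    have hpm : Measurable p := by
      refine Measurable.lintegral_prod_right' (f := fun q : Ω × (Fin n → Ω) =>
        ENNReal.ofReal (Real.exp (-V (Fin.cons q.1 q.2)))) ?_
      exact measurable_ofReal_exp (hV.comp hcons).neg
    have hp1 : ∀ w, p w ≤ 1 := fun w => by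
      calc p w ≤ ∫⁻ _, 1 ∂μ := lintegral_mono fun y => by
            rw [← ENNReal.ofReal_one]
            exact ENNReal.ofReal_le_ofReal (Real.exp_le_one_iff.2 (by simpa using hV0 _))
        _ = 1 := by simp
    have hp0 : ∀ w, 0 < p w := fun w => by
      rw [hp, lintegral_pos_iff_support]
      · have : (Function.support fun y : Fin n → Ω =>
            ENNReal.ofReal (Real.exp (-V (Fin.cons w y)))) = Set.univ := by
          ext y; simp [Real.exp_pos]
        rw [this]; simp
      · exact measurable_ofReal_exp (hVc w).neg
    obtain ⟨k, hk⟩ : ∃ k, ∀ w, p w ≤ p (o k) := by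
      rcases hmon with h | h
      · obtain ⟨k, hk⟩ := Finite.exists_max fun k => p (o k)
        refine ⟨k, fun w => ?_⟩
        obtain ⟨j, rfl⟩ := h w
        exact hk j
      · obtain ⟨k⟩ := ‹Nonempty κ›
        refine ⟨k, fun w => lintegral_mono fun y => ?_⟩
        refine ENNReal.ofReal_le_ofReal (Real.exp_le_exp.2 (neg_le_neg ?_))
        simpa using h 0 (Fin.cons w y) k
    have ih' : ∀ w, (∫⁻ y, ENNReal.ofReal (Real.exp
        (infConv o n (fun y => V (Fin.cons w y)) y)) ∂μ) ≤ (p w)⁻¹ := fun w => by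
      rw [ENNReal.le_inv_iff_mul_le]
      refine ih _ (hVc w) (fun y => hV0 _) (hmon.imp_right fun h i x k => ?_)
      simpa [Fin.cons_update] using h i.succ (Fin.cons w x) k
    set q := p (o k) with hq
    have hq0 := hp0 (o k)
    have hq1 := hp1 (o k)
    have hqt : q ≠ ∞ := (hq1.trans_lt ENNReal.one_lt_top).ne
    set F : Ω → ℝ≥0∞ := fun w =>
      ∫⁻ y, ENNReal.ofReal (Real.exp (infConv o (n + 1) V (Fin.cons w y))) ∂μ with hF
    have step : ∀ w, F w + p w / q ^ 2 ≤ 2 / q := fun w => by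
      have hpt : p w ≠ ∞ := ((hp1 w).trans_lt ENNReal.one_lt_top).ne
      obtain ⟨θ, h0, h1, h⟩ := exists_interpolation_le (p := (p w).toReal) (q := q.toReal)
        (ENNReal.toReal_pos (hp0 w).ne' hpt) (ENNReal.toReal_mono hqt (hk w))
      have hF1 : F w ≤ ENNReal.ofReal (Real.exp (θ ^ 2 / 8)) *
          ((p w)⁻¹ ^ (1 - θ) * q⁻¹ ^ θ) := by
        calc F w ≤ ∫⁻ y, ENNReal.ofReal (Real.exp (θ ^ 2 / 8)) *
              (ENNReal.ofReal (Real.exp (infConv o n (fun y => V (Fin.cons w y)) y)) ^ (1 - θ)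
              * ENNReal.ofReal (Real.exp (infConv o n (fun y => V (Fin.cons (o k) y)) y)) ^ θ)
                ∂μ := by
              refine lintegral_mono fun y => ?_
              rw [ENNReal.ofReal_rpow_of_pos (Real.exp_pos _),
                ENNReal.ofReal_rpow_of_pos (Real.exp_pos _),
                ← ENNReal.ofReal_mul (by positivity), ← ENNReal.ofReal_mul (by positivity),
                ← Real.exp_mul, ← Real.exp_mul, ← Real.exp_add, ← Real.exp_add]
              refine ENNReal.ofReal_le_ofReal (Real.exp_le_exp.2 ?_)
              simp only [infConv, Fin.cons_zero, Fin.tail_cons]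
              refine (ciInf_le (Set.finite_range _).bddBelow k).trans
                ((quadMin_le _ _ θ h0 h1).trans (le_of_eq ?_))
              ring
          _ = ENNReal.ofReal (Real.exp (θ ^ 2 / 8)) * ∫⁻ y, 
              (ENNReal.ofReal (Real.exp (infConv o n (fun y => V (Fin.cons w y)) y)) ^ (1 - θ)
              * ENNReal.ofReal (Real.exp (infConv o n (fun y => V (Fin.cons (o k) y)) y)) ^ θ)
                ∂μ := lintegral_const_mul' _ _ ENNReal.ofReal_ne_top
          _ ≤ _ := by
              gcongr
              refine (ENNReal.lintegral_mul_norm_pow_le ?_ ?_ (by linarith) h0 (by ring)).trans ?_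
              · exact (measurable_ofReal_exp (measurable_infConv o n (hVc w))).aemeasurable
              · exact (measurable_ofReal_exp (measurable_infConv o n (hVc (o k)))).aemeasurable
              · exact mul_le_mul' (ENNReal.rpow_le_rpow (ih' w) (by linarith))
                  (ENNReal.rpow_le_rpow (ih' (o k)) h0)
      have hpr : p w = ENNReal.ofReal (p w).toReal := (ENNReal.ofReal_toReal hpt).symm
      have hqr : q = ENNReal.ofReal q.toReal := (ENNReal.ofReal_toReal hqt).symm
      have hpp := ENNReal.toReal_pos (hp0 w).ne' hpt
      have hqp := ENNReal.toReal_pos hq0.ne' hqt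
      refine (add_le_add_left hF1 _).trans ?_
      rw [hpr, hqr, ← ENNReal.ofReal_inv_of_pos hpp, ← ENNReal.ofReal_inv_of_pos hqp,
        ENNReal.ofReal_rpow_of_pos (inv_pos.2 hpp), ENNReal.ofReal_rpow_of_pos (inv_pos.2 hqp),
        ← ENNReal.ofReal_mul (by positivity), ← ENNReal.ofReal_mul (by positivity),
        ← ENNReal.ofReal_pow hqp.le, ← ENNReal.ofReal_div_of_pos (by positivity),
        ← ENNReal.ofReal_add (by positivity) (by positivity),
        show (2 : ℝ≥0∞) = ENNReal.ofReal 2 by simp, ← ENNReal.ofReal_div_of_pos hqp]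
      exact ENNReal.ofReal_le_ofReal h
    rw [lintegral_pi_succ P n (measurable_ofReal_exp (measurable_infConv o (n + 1) hV)),
      lintegral_pi_succ P n (measurable_ofReal_exp (f := fun x => -V x) hV.neg)]
    change (∫⁻ w, F w ∂P) * ∫⁻ w, p w ∂P ≤ 1
    have hsum : (∫⁻ w, F w ∂P) + (∫⁻ w, p w ∂P) / q ^ 2 ≤ 2 / q := by
      calc (∫⁻ w, F w ∂P) + (∫⁻ w, p w ∂P) / q ^ 2 = ∫⁻ w, (F w + p w / q ^ 2) ∂P := by
            rw [lintegral_add_right _ (hpm.div_const _)]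
            simp only [div_eq_mul_inv]
            rw [lintegral_mul_const _ hpm]
        _ ≤ ∫⁻ _, 2 / q ∂P := lintegral_mono step
        _ = 2 / q := by simp
    set I := ∫⁻ w, F w ∂P
    set J := ∫⁻ w, p w ∂P
    have hJ1 : J ≤ 1 := (lintegral_mono hp1).trans (by simp)
    have hJt : J ≠ ∞ := (hJ1.trans_lt ENNReal.one_lt_top).ne
    have h2q : 2 / q ≠ ∞ := ENNReal.div_ne_top (by simp) hq0.ne'
    have hIt : I ≠ ∞ := ((le_self_add.trans hsum).trans_lt h2q.lt_top).ne
    have hJq : J / q ^ 2 ≠ ∞ := ((le_add_self.trans hsum).trans_lt h2q.lt_top).ne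
    have hr := ENNReal.toReal_mono h2q hsum
    rw [ENNReal.toReal_add hIt hJq, ENNReal.toReal_div, ENNReal.toReal_div, ENNReal.toReal_pow]
      at hr
    rw [← ENNReal.ofReal_toReal (ENNReal.mul_ne_top hIt hJt), ← ENNReal.ofReal_one]
    refine ENNReal.ofReal_le_ofReal ?_
    rw [ENNReal.toReal_mul]
    have hqp := ENNReal.toReal_pos hq0.ne' hqt
    have hJ0 : 0 ≤ J.toReal := ENNReal.toReal_nonneg
    have e : (I.toReal + J.toReal / q.toReal ^ 2) * J.toReal
        ≤ ENNReal.toReal 2 / q.toReal * J.toReal := mul_le_mul_of_nonneg_right hr hJ0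
    have e2 : I.toReal * J.toReal ≤ 2 * (J.toReal / q.toReal) - (J.toReal / q.toReal) ^ 2 := by
      have : ENNReal.toReal 2 = 2 := by simp
      rw [this] at e
      have e3 : (J.toReal / q.toReal) ^ 2 = J.toReal / q.toReal ^ 2 * J.toReal := by field_simp
      have e4 : 2 * (J.toReal / q.toReal) = 2 / q.toReal * J.toReal := by ring
      rw [e3, e4]; linarith
    nlinarith [sq_nonneg (J.toReal / q.toReal - 1)]

end InfimumConvolution

lemma ofReal_exp_integral_le {Ω : Type*} [MeasurableSpace Ω] (μ : Measure Ω)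
    [IsProbabilityMeasure μ] {f : Ω → ℝ} (hf : Integrable f μ) :
    ENNReal.ofReal (Real.exp (∫ x, f x ∂μ)) ≤ ∫⁻ x, ENNReal.ofReal (Real.exp (f x)) ∂μ := by
  by_cases h : ∫⁻ x, ENNReal.ofReal (Real.exp (f x)) ∂μ = ∞
  · simp [h]
  · have hi : Integrable (fun x => Real.exp (f x)) μ := by
      refine ⟨Real.continuous_exp.comp_aestronglyMeasurable hf.1, ?_⟩
      rw [hasFiniteIntegral_iff_ofReal (Filter.Eventually.of_forall fun x => (Real.exp_pos _).le)]
      exact Ne.lt_top h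
    rw [← ofReal_integral_eq_lintegral_ofReal hi
      (Filter.Eventually.of_forall fun x => (Real.exp_pos _).le)]
    exact ENNReal.ofReal_le_ofReal (convexOn_exp.map_integral_le Real.continuous_exp.continuousOn
      isClosed_univ (by simp) hf hi)

lemma lintegral_exp_le_of_le_infConv {Ω κ : Type*} [MeasurableSpace Ω] (P : Measure Ω)
    [IsProbabilityMeasure P] [Finite κ] [Nonempty κ] (o : κ → Ω) (n : ℕ)
    {U V : (Fin n → Ω) → ℝ} (hV : Measurable V) (hV0 : ∀ x, 0 ≤ V x)
    (hmon : (∀ w, ∃ k, o k = w) ∨ ∀ i x k, V (Function.update x i (o k)) ≤ V x)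
    (hint : Integrable V (Measure.pi fun _ : Fin n => P))
    (hUV : ∀ᵐ x ∂(Measure.pi fun _ : Fin n => P), U x ≤ infConv o n V x) :
    ∫⁻ x, ENNReal.ofReal (Real.exp (U x)) ∂(Measure.pi fun _ : Fin n => P)
      ≤ ENNReal.ofReal (Real.exp (∫ x, V x ∂(Measure.pi fun _ : Fin n => P))) := by
  set μ := Measure.pi fun _ : Fin n => P
  have h1 := lintegral_exp_infConv_mul_le P o n V hV hV0 hmon
  have h2 := ofReal_exp_integral_le μ hint.neg
  have h3 : ENNReal.ofReal (Real.exp (∫ x, (-V) x ∂μ))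
      = (ENNReal.ofReal (Real.exp (∫ x, V x ∂μ)))⁻¹ := by
    rw [← ENNReal.ofReal_inv_of_pos (Real.exp_pos _), ← Real.exp_neg]
    simp [integral_neg]
  rw [h3] at h2
  have h4 : (∫⁻ x, ENNReal.ofReal (Real.exp (infConv o n V x)) ∂μ)
      * (ENNReal.ofReal (Real.exp (∫ x, V x ∂μ)))⁻¹ ≤ 1 := (mul_le_mul' le_rfl h2).trans h1
  have h5 := ENNReal.le_inv_iff_mul_le.2 h4
  rw [inv_inv] at h5
  refine (lintegral_mono_ae ?_).trans h5
  filter_upwards [hUV] with x hx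
  exact ENNReal.ofReal_le_ofReal (Real.exp_le_exp.2 hx)

section Rademacher

/-- The sign attached to a Boolean. -/
noncomputable def boolSign (b : Bool) : ℝ := if b then 1 else -1

/-- The supremum over `j` of the signed sums `∑ i, ε i * v i j`. -/
noncomputable def radSup {ι : Type*} {n : ℕ} (v : Fin n → ι → ℝ) (ε : Fin n → Bool) : ℝ :=
  ⨆ j, ∑ i, boolSign (ε i) * v i j

/-- The average of `radSup v` over all sign patterns. -/
noncomputable def radAvg {ι : Type*} {n : ℕ} (v : Fin n → ι → ℝ) : ℝ :=
  (∑ ε : Fin n → Bool, radSup v ε) / 2 ^ n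

/-- The supremum over `j` of the sums of squares `∑ i, v i j ^ 2`. -/
noncomputable def sqSup {ι : Type*} {n : ℕ} (v : Fin n → ι → ℝ) : ℝ :=
  ⨆ j, ∑ i, v i j ^ 2

lemma boolSign_not (b : Bool) : boolSign (!b) = -boolSign b := by
  cases b <;> simp [boolSign]

lemma abs_boolSign (b : Bool) : |boolSign b| = 1 := by
  cases b <;> simp [boolSign]

variable {ι : Type*} {n : ℕ}

lemma le_iSup_of_finite [Finite ι] (f : ι → ℝ) (j : ι) : f j ≤ ⨆ k, f k :=
  le_ciSup (Set.finite_range f).bddAbove j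

lemma le_radSup [Finite ι] (v : Fin n → ι → ℝ) (ε : Fin n → Bool) (j : ι) :
    ∑ i, boolSign (ε i) * v i j ≤ radSup v ε :=
  le_iSup_of_finite (fun j => ∑ i, boolSign (ε i) * v i j) j

lemma le_sqSup [Finite ι] (v : Fin n → ι → ℝ) (j : ι) : ∑ i, v i j ^ 2 ≤ sqSup v :=
  le_iSup_of_finite (fun j => ∑ i, v i j ^ 2) j

lemma sqSup_nonneg [Finite ι] [Nonempty ι] (v : Fin n → ι → ℝ) : 0 ≤ sqSup v := by
  obtain ⟨j⟩ := ‹Nonempty ι›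
  exact (Finset.sum_nonneg fun i _ => sq_nonneg _).trans (le_sqSup v j)

lemma measurable_radSup [Finite ι] (ε : Fin n → Bool) :
    Measurable fun v : Fin n → ι → ℝ => radSup v ε := by
  unfold radSup
  exact Measurable.iSup fun j => by fun_prop

lemma measurable_radAvg [Finite ι] : Measurable fun v : Fin n → ι → ℝ => radAvg v := by
  unfold radAvg
  exact (Finset.measurable_sum _ fun ε _ => measurable_radSup ε).div_const _

lemma measurable_sqSup [Finite ι] : Measurable fun v : Fin n → ι → ℝ => sqSup v := by
  unfold sqSup
  exact Measurable.iSup fun j => by fun_prop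

lemma radAvg_nonneg [Finite ι] [Nonempty ι] (v : Fin n → ι → ℝ) : 0 ≤ radAvg v := by
  obtain ⟨j⟩ := ‹Nonempty ι›
  refine div_nonneg ?_ (by positivity)
  have hinv : Function.Involutive fun ε : Fin n → Bool => fun i => !ε i := fun ε => by simp
  have h : ∑ ε : Fin n → Bool, radSup v (fun i => !ε i) = ∑ ε : Fin n → Bool, radSup v ε :=
    hinv.bijective.sum_comp (radSup v)
  have h2 : 0 ≤ ∑ ε : Fin n → Bool, (radSup v ε + radSup v (fun i => !ε i)) := by
    refine Finset.sum_nonneg fun ε _ => ?_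
    have h1 := le_radSup v ε j
    have h2 := le_radSup v (fun i => !ε i) j
    simp only [boolSign_not, neg_mul, Finset.sum_neg_distrib] at h2
    linarith
  rw [Finset.sum_add_distrib, h] at h2
  linarith

lemma radAvg_update_zero_le [Finite ι] [Nonempty ι] (v : Fin n → ι → ℝ) (i : Fin n) :
    radAvg (Function.update v i 0) ≤ radAvg v := by
  refine div_le_div_of_nonneg_right ?_ (by positivity)
  have hinv : Function.Involutive fun ε : Fin n → Bool => Function.update ε i (!ε i) :=
    fun ε => by simp
  have h : ∑ ε : Fin n → Bool, radSup v (Function.update ε i (!ε i))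
      = ∑ ε : Fin n → Bool, radSup v ε := hinv.bijective.sum_comp (radSup v)
  have h2 : ∑ ε : Fin n → Bool, 2 * radSup (Function.update v i 0) ε
      ≤ ∑ ε : Fin n → Bool, (radSup v ε + radSup v (Function.update ε i (!ε i))) := by
    refine Finset.sum_le_sum fun ε _ => ?_
    have : radSup (Function.update v i 0) ε
        ≤ (radSup v ε + radSup v (Function.update ε i (!ε i))) / 2 := by
      refine ciSup_le fun j => ?_
      have h1 := le_radSup v ε j
      have h2 := le_radSup v (Function.update ε i (!ε i)) j
      have h3 : ∑ k, boolSign (ε k) * Function.update v i 0 k j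
          = (∑ k, boolSign (ε k) * v k j
            + ∑ k, boolSign (Function.update ε i (!ε i) k) * v k j) / 2 := by
        rw [← Finset.sum_add_distrib, Finset.sum_div]
        refine Finset.sum_congr rfl fun k _ => ?_
        by_cases hk : k = i
        · subst hk; simp [boolSign_not]
        · simp [Function.update_of_ne hk]
      rw [h3]; linarith
    linarith
  rw [← Finset.mul_sum, Finset.sum_add_distrib, h] at h2
  linarith

lemma sqSup_update_zero_le [Finite ι] [Nonempty ι] (v : Fin n → ι → ℝ) (i : Fin n) :
    sqSup (Function.update v i 0) ≤ sqSup v := by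
  refine ciSup_le fun j => (Finset.sum_le_sum fun k _ => ?_).trans (le_sqSup v j)
  by_cases hk : k = i
  · subst hk; simp [sq_nonneg]
  · simp [Function.update_of_ne hk]

lemma sum_iSup_add_le_of_contraction [Finite ι] [Nonempty ι] (n : ℕ) :
    ∀ (a : ι → ℝ) (g t : Fin n → ι → ℝ) (_ : ∀ i j k, |g i j - g i k| ≤ |t i j - t i k|),
      ∑ ε : Fin n → Bool, ⨆ j, (a j + ∑ i, boolSign (ε i) * g i j)
        ≤ ∑ ε : Fin n → Bool, ⨆ j, (a j + ∑ i, boolSign (ε i) * t i j) := by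
  induction n with
  | zero => intro a g t h; simp
  | succ n ih =>
    intro a g t h
    have one : ∀ c : ι → ℝ, (⨆ j, (c j + g 0 j)) + (⨆ j, (c j - g 0 j))
        ≤ (⨆ j, (c j + t 0 j)) + ⨆ j, (c j - t 0 j) := fun c => by
      obtain ⟨j, hj⟩ := exists_eq_ciSup_of_finite (f := fun j => c j + g 0 j)
      obtain ⟨k, hk⟩ := exists_eq_ciSup_of_finite (f := fun j => c j - g 0 j)
      rw [← hj, ← hk]
      have h1 := le_iSup_of_finite (fun j => c j + t 0 j) j
      have h2 := le_iSup_of_finite (fun j => c j + t 0 j) k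
      have h3 := le_iSup_of_finite (fun j => c j - t 0 j) j
      have h4 := le_iSup_of_finite (fun j => c j - t 0 j) k
      have h5 := (le_abs_self _).trans (h 0 j k)
      rcases abs_cases (t 0 j - t 0 k) with h6 | h6 <;> linarith
    have split : ∀ v : Fin (n + 1) → ι → ℝ,
        ∑ ε : Fin (n + 1) → Bool, ⨆ j, (a j + ∑ i, boolSign (ε i) * v i j)
        = ∑ b : Bool, ∑ ε : Fin n → Bool,
            ⨆ j, ((a j + boolSign b * v 0 j) + ∑ i, boolSign (ε i) * v i.succ j) := fun v => by
      rw [← (Fin.consEquiv fun _ => Bool).sum_comp, Fintype.sum_prod_type]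
      simp only [Fin.consEquiv_apply, Fin.sum_univ_succ, Fin.cons_zero, Fin.cons_succ, add_assoc]
    rw [split, split]
    calc ∑ b : Bool, ∑ ε : Fin n → Bool,
            ⨆ j, ((a j + boolSign b * g 0 j) + ∑ i, boolSign (ε i) * g i.succ j)
        ≤ ∑ b : Bool, ∑ ε : Fin n → Bool,
            ⨆ j, ((a j + boolSign b * g 0 j) + ∑ i, boolSign (ε i) * t i.succ j) :=
          Finset.sum_le_sum fun b _ => ih _ _ _ fun i => h i.succ
      _ ≤ _ := by
          rw [Finset.sum_comm, Finset.sum_comm (s := (Finset.univ : Finset Bool))]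
          refine Finset.sum_le_sum fun ε _ => ?_
          have := one fun j => a j + ∑ i, boolSign (ε i) * t i.succ j
          simp only [Fintype.sum_bool, boolSign, if_true, Bool.false_eq_true, if_false, one_mul,
            neg_mul, ← sub_eq_add_neg] at this ⊢
          simpa only [add_right_comm, sub_add_eq_add_sub] using this

lemma radAvg_le_of_contraction [Finite ι] [Nonempty ι] {g t : Fin n → ι → ℝ}
    (h : ∀ i j k, |g i j - g i k| ≤ |t i j - t i k|) : radAvg g ≤ radAvg t := by
  refine div_le_div_of_nonneg_right ?_ (by positivity)
  simpa [radSup] using sum_iSup_add_le_of_contraction n (fun _ => 0) g t h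

lemma sqSup_le_of_abs_le [Finite ι] [Nonempty ι] {g t : Fin n → ι → ℝ}
    (h : ∀ i j, |g i j| ≤ |t i j|) :
    sqSup g ≤ sqSup t :=
  ciSup_le fun j => (Finset.sum_le_sum fun i _ => sq_le_sq.2 (h i j)).trans (le_sqSup t j)

theorem sum_exp_radSup_le [Finite ι] [Nonempty ι] (v : Fin n → ι → ℝ) (j₀ : ι)
    (h0 : ∀ i, v i j₀ = 0) {lam : ℝ}
    (hlam : 0 ≤ lam) :
    (∑ ε : Fin n → Bool, Real.exp (lam * radSup v ε)) / 2 ^ n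
      ≤ Real.exp (lam * radAvg v + 8 * lam ^ 2 * sqSup v) := by
  set ρ : Measure Bool := (2⁻¹ : ℝ≥0∞) • Measure.count with hρ
  have hρ1 : ∀ b, ρ {b} = 2⁻¹ := fun b => by simp [hρ]
  have : IsProbabilityMeasure ρ := ⟨by
    rw [hρ, Measure.smul_apply, Measure.count_univ, smul_eq_mul]
    simp [ENNReal.inv_mul_cancel]⟩
  set μ := Measure.pi fun _ : Fin n => ρ with hμ
  have hμ1 : ∀ ε, μ {ε} = (2⁻¹ : ℝ≥0∞) ^ n := fun ε => by
    rw [hμ, Measure.pi_singleton]; simp [hρ1]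
  have key := lintegral_exp_le_of_le_infConv ρ (id : Bool → Bool) n
    (U := fun ε => lam * radSup v ε - 8 * lam ^ 2 * sqSup v) (V := fun ε => lam * radSup v ε)
    (measurable_of_finite _)
    (fun ε => mul_nonneg hlam (by simpa [h0] using le_radSup v ε j₀))
    (Or.inl fun w => ⟨w, rfl⟩) (Integrable.of_finite) (Filter.Eventually.of_forall fun ε => by
      obtain ⟨j, hj⟩ := exists_eq_ciSup_of_finite (f := fun j => ∑ i, boolSign (ε i) * v i j)
      refine le_infConv _ n _ ε _ (fun i => 2 * lam * |v i j|) fun S y hy _ => ?_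
      have h1 : ∑ i, (2 * lam * |v i j|) ^ 2 ≤ 4 * lam ^ 2 * sqSup v := by
        calc ∑ i, (2 * lam * |v i j|) ^ 2 = 4 * lam ^ 2 * ∑ i, v i j ^ 2 := by
              rw [Finset.mul_sum]
              refine Finset.sum_congr rfl fun i _ => ?_
              rw [mul_pow, sq_abs]; ring
          _ ≤ _ := mul_le_mul_of_nonneg_left (le_sqSup v j) (by positivity)
      have h2 : lam * radSup v ε ≤ lam * radSup v y
          + ∑ i, if S i then 0 else 2 * lam * |v i j| := by
        calc lam * radSup v ε = lam * ∑ i, boolSign (ε i) * v i j := by rw [radSup, ← hj]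
          _ ≤ lam * (∑ i, boolSign (y i) * v i j) + ∑ i, if S i then 0 else 2 * lam * |v i j| := by
              rw [Finset.mul_sum, Finset.mul_sum, ← Finset.sum_add_distrib]
              refine Finset.sum_le_sum fun i _ => ?_
              cases hS : S i
              · have a1 := neg_abs_le (boolSign (y i) * v i j)
                have a2 := le_abs_self (boolSign (ε i) * v i j)
                rw [abs_mul, abs_boolSign, one_mul] at a1 a2
                simp only [Bool.false_eq_true, if_false]
                nlinarith
              · simp [hy i hS]
          _ ≤ _ := by
              gcongr
              exact le_radSup v y j
      linarith)
  rw [lintegral_fintype, integral_fintype Integrable.of_finite] at key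
  have e1 : ∀ ε, μ.real {ε} = (2 ^ n)⁻¹ := fun ε => by
    rw [Measure.real, hμ1]; simp
  have e2 : ∀ ε, μ {ε} = ENNReal.ofReal ((2 ^ n)⁻¹) := fun ε => by
    rw [← e1 ε]; simp [Measure.real]
  have e3 : ∑ ε : Fin n → Bool, μ.real {ε} • (lam * radSup v ε) = lam * radAvg v := by
    simp only [e1, smul_eq_mul, ← Finset.mul_sum, radAvg]
    field_simp
  rw [e3] at key
  have e4 : ∑ ε : Fin n → Bool,
      ENNReal.ofReal (Real.exp (lam * radSup v ε - 8 * lam ^ 2 * sqSup v)) * μ {ε}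
      = ENNReal.ofReal ((∑ ε : Fin n → Bool, Real.exp (lam * radSup v ε)) / 2 ^ n
        * Real.exp (-(8 * lam ^ 2 * sqSup v))) := by
    rw [div_mul_eq_mul_div, div_eq_mul_inv, Finset.sum_mul, Finset.sum_mul,
      ENNReal.ofReal_sum_of_nonneg fun _ _ => by positivity]
    refine Finset.sum_congr rfl fun ε _ => ?_
    rw [e2, ← ENNReal.ofReal_mul (Real.exp_pos _).le, sub_eq_add_neg, Real.exp_add]
  rw [e4, ENNReal.ofReal_le_ofReal_iff (Real.exp_pos _).le, Real.exp_neg,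
    ← div_eq_mul_inv, div_le_iff₀ (Real.exp_pos _), ← Real.exp_add] at key
  exact key

lemma abs_radSup_le [Finite ι] [Nonempty ι] {v : Fin n → ι → ℝ} {b : ℝ} (hv : ∀ i j, |v i j| ≤ b)
    (ε : Fin n → Bool) :
    |radSup v ε| ≤ n * b := by
  have h : ∀ j, |∑ i, boolSign (ε i) * v i j| ≤ n * b := fun j => by
    calc |∑ i, boolSign (ε i) * v i j| ≤ ∑ i, |boolSign (ε i) * v i j| :=
          Finset.abs_sum_le_sum_abs _ _
      _ ≤ ∑ _i : Fin n, b := Finset.sum_le_sum fun i _ => by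
          rw [abs_mul, abs_boolSign, one_mul]; exact hv i j
      _ = n * b := by simp
  obtain ⟨j, hj⟩ := exists_eq_ciSup_of_finite (f := fun j => ∑ i, boolSign (ε i) * v i j)
  rw [radSup, ← hj]
  exact h j

lemma radAvg_le_of_abs_le [Finite ι] [Nonempty ι] {v : Fin n → ι → ℝ} {b : ℝ}
    (hv : ∀ i j, |v i j| ≤ b) :
    radAvg v ≤ n * b := by
  rw [radAvg, div_le_iff₀ (by positivity)]
  calc ∑ ε : Fin n → Bool, radSup v ε ≤ ∑ _ε : Fin n → Bool, n * b :=
        Finset.sum_le_sum fun ε _ => (le_abs_self _).trans (abs_radSup_le hv ε)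
    _ = _ := by simp; ring

lemma sqSup_le_of_bound [Nonempty ι] {v : Fin n → ι → ℝ} {b : ℝ} (hv : ∀ i j, |v i j| ≤ b) :
    sqSup v ≤ n * b ^ 2 :=
  ciSup_le fun j => by
    calc ∑ i, v i j ^ 2 ≤ ∑ _i : Fin n, b ^ 2 := Finset.sum_le_sum fun i _ => by
          rw [← sq_abs]; exact pow_le_pow_left₀ (abs_nonneg _) (hv i j) 2
      _ = _ := by simp

theorem lintegral_exp_half_le [Finite ι] [Nonempty ι] (Q : Measure (ι → ℝ))
    [IsProbabilityMeasure Q] {b s q : ℝ}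
    (hb : ∀ᵐ x ∂Q, ∀ j, |x j| ≤ b) (hs : 0 ≤ s) (hq : 0 ≤ q) (hsq : s * b + q * b ^ 2 ≤ 1 / 4) :
    ∫⁻ v, ENNReal.ofReal (Real.exp ((s * radAvg v + q * sqSup v) / 2))
        ∂(Measure.pi fun _ : Fin n => Q)
      ≤ ENNReal.ofReal (Real.exp (∫ v, (s * radAvg v + q * sqSup v)
        ∂(Measure.pi fun _ : Fin n => Q))) := by
  have hbd : ∀ᵐ v ∂(Measure.pi fun _ : Fin n => Q), ∀ i j, |v i j| ≤ b :=
    ae_all_iff.2 fun i =>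
      (measurePreserving_eval (fun _ : Fin n => Q) i).quasiMeasurePreserving.ae hb
  have hmeas : Measurable fun v : Fin n → ι → ℝ => s * radAvg v + q * sqSup v :=
    (measurable_radAvg.const_mul s).add (measurable_sqSup.const_mul q)
  have hnn : ∀ v : Fin n → ι → ℝ, 0 ≤ s * radAvg v + q * sqSup v := fun v =>
    add_nonneg (mul_nonneg hs (radAvg_nonneg v)) (mul_nonneg hq (sqSup_nonneg v))
  have hmon : ∀ (i : Fin n) (v : Fin n → ι → ℝ),
      s * radAvg (Function.update v i 0) + q * sqSup (Function.update v i 0)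
        ≤ s * radAvg v + q * sqSup v := fun i v => by
    gcongr
    · exact radAvg_update_zero_le v i
    · exact sqSup_update_zero_le v i
  refine lintegral_exp_le_of_le_infConv Q (fun _ : Unit => (0 : ι → ℝ)) n hmeas hnn
    (Or.inr fun i v _ => hmon i v) ?_ ?_
  · refine Integrable.of_bound hmeas.aestronglyMeasurable (s * (n * b) + q * (n * b ^ 2)) ?_
    filter_upwards [hbd] with v hv
    rw [Real.norm_of_nonneg (hnn v)]
    gcongr
    · exact radAvg_le_of_abs_le hv
    · exact sqSup_le_of_bound hv
  · filter_upwards [hbd] with v hv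
    choose φ hφ using fun ε : Fin n → Bool =>
      exists_eq_ciSup_of_finite (f := fun j => ∑ i, boolSign (ε i) * v i j)
    obtain ⟨l, hl⟩ := exists_eq_ciSup_of_finite (f := fun j => ∑ i, v i j ^ 2)
    set α : Fin n → ℝ := fun i =>
      s * ((∑ ε : Fin n → Bool, boolSign (ε i) * v i (φ ε)) / 2 ^ n) + q * v i l ^ 2 with hα
    have hsum : ∀ T : Fin n → Bool, ∑ i, (if T i then α i else 0)
        = s * ((∑ ε : Fin n → Bool, ∑ i, if T i then boolSign (ε i) * v i (φ ε) else 0) / 2 ^ n)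
          + q * ∑ i, if T i then v i l ^ 2 else 0 := fun T => by
      rw [Finset.sum_comm, Finset.sum_div, Finset.mul_sum, Finset.mul_sum,
        ← Finset.sum_add_distrib]
      refine Finset.sum_congr rfl fun i _ => ?_
      cases T i <;> simp [hα]
    have htot : ∑ i, α i = s * radAvg v + q * sqSup v := by
      have := hsum fun _ => true
      simp only [if_true] at this
      rw [this, radAvg, sqSup, ← hl]
      simp only [radSup, ← hφ]
    have hcert : ∀ (S : Fin n → Bool) (y : Fin n → ι → ℝ), (∀ i, S i = true → y i = v i) →
        (∀ i, S i = false → y i = 0) → s * radAvg v + q * sqSup v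
          ≤ (s * radAvg y + q * sqSup y) + ∑ i, if S i then 0 else α i := fun S y h1 h2 => by
      have e : ∑ i, α i = (∑ i, if S i then α i else 0) + ∑ i, if S i then 0 else α i := by
        rw [← Finset.sum_add_distrib]
        exact Finset.sum_congr rfl fun i _ => by cases S i <;> simp
      rw [← htot, e, hsum]
      gcongr
      · rw [radAvg]
        gcongr with ε
        refine le_trans (le_of_eq (Finset.sum_congr rfl fun i _ => ?_)) (le_radSup y ε (φ ε))
        cases hS : S i
        · simp [h2 i hS]
        · simp [h1 i hS]
      · refine le_trans (le_of_eq (Finset.sum_congr rfl fun i _ => ?_)) (le_sqSup y l)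
        cases hS : S i
        · simp [h2 i hS]
        · simp [h1 i hS]
    have hα0 : ∀ i, 0 ≤ α i := fun i => by
      have h1 := hcert (fun k => decide (k ≠ i)) (Function.update v i 0)
        (fun k hk => Function.update_of_ne (by simpa using hk) _ _)
        (fun k hk => by
          have : k = i := by simpa using hk
          simp [this])
      have h2 : (∑ k, if decide (k ≠ i) = true then 0 else α k) = α i := by
        rw [Finset.sum_eq_single i]
        · simp
        · intro k _ hk; simp [hk]
        · simp
      rw [h2] at h1
      linarith [hmon i v]
    have hα1 : ∀ i, α i ≤ 1 / 4 := fun i => by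
      refine le_trans ?_ hsq
      rw [hα]
      dsimp only
      refine add_le_add (mul_le_mul_of_nonneg_left ?_ hs) (mul_le_mul_of_nonneg_left ?_ hq)
      · rw [div_le_iff₀ (by positivity)]
        calc ∑ ε : Fin n → Bool, boolSign (ε i) * v i (φ ε) ≤ ∑ _ε : Fin n → Bool, b :=
              Finset.sum_le_sum fun ε _ => (le_abs_self _).trans (by
                rw [abs_mul, abs_boolSign, one_mul]; exact hv i _)
          _ = _ := by simp; ring
      · exact sq_le_sq.2 ((hv i l).trans (le_abs_self b))
    refine le_infConv _ n _ v _ α fun S y h1 h2 => ?_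
    have hc := hcert S y h1 fun i hi => by
      obtain ⟨_, h⟩ := h2 i hi
      exact h
    have hsq : ∑ i, α i ^ 2 ≤ 1 / 4 * ∑ i, α i := by
      rw [Finset.mul_sum]
      exact Finset.sum_le_sum fun i _ => by nlinarith [hα0 i, hα1 i]
    rw [htot] at hsq
    linarith

end Rademacher

section Symmetrization

variable {Ω ι : Type*} [MeasurableSpace Ω] {n : ℕ}

lemma integrable_eval_pi (P : Measure Ω) [IsProbabilityMeasure P] {h : Ω → ℝ}
    (hh : Integrable h P) (i : Fin n) :
    Integrable (fun x : Fin n → Ω => h (x i)) (Measure.pi fun _ : Fin n => P) :=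
  integrable_comp_eval (μ := fun _ : Fin n => P) (i := i) hh

lemma integral_sum_sub_pi (P : Measure Ω) [IsProbabilityMeasure P] {h : Ω → ℝ}
    (hh : Integrable h P) (c : Fin n → ℝ) :
    ∫ x, ∑ i, (h (x i) - c i) ∂(Measure.pi fun _ : Fin n => P) = ∑ i, ((∫ z, h z ∂P) - c i) := by
  rw [integral_finsetSum (f := fun i (x : Fin n → Ω) => h (x i) - c i) _ fun i _ =>
    (integrable_eval_pi P hh i).sub (integrable_const _)]
  refine Finset.sum_congr rfl fun i _ => ?_
  rw [integral_sub (integrable_eval_pi P hh i) (integrable_const _),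
    integral_comp_eval (μ := fun _ : Fin n => P) (i := i) hh.aestronglyMeasurable]
  simp

lemma iSup_integral_sub_le [Finite ι] [Nonempty ι] (P : Measure Ω) [IsProbabilityMeasure P]
    {g : Ω → ι → ℝ} (hg : ∀ j, Measurable fun z => g z j)
    (hi : ∀ j, Integrable (fun z => g z j) P) (x : Fin n → Ω) :
    Integrable (fun y : Fin n → Ω => ⨆ j, ∑ i, (g (y i) j - g (x i) j))
      (Measure.pi fun _ : Fin n => P) ∧
    ⨆ j, ∑ i, ((∫ z, g z j ∂P) - g (x i) j)
      ≤ ∫ y, ⨆ j, ∑ i, (g (y i) j - g (x i) j) ∂(Measure.pi fun _ : Fin n => P) := by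
  cases nonempty_fintype ι
  have h1 : ∀ j, Integrable (fun y : Fin n → Ω => ∑ i, (g (y i) j - g (x i) j))
      (Measure.pi fun _ : Fin n => P) := fun j =>
    integrable_finsetSum _ fun i _ => (integrable_eval_pi P (hi j) i).sub (integrable_const _)
  have h2 : Integrable (fun y : Fin n → Ω => ⨆ j, ∑ i, (g (y i) j - g (x i) j))
      (Measure.pi fun _ : Fin n => P) := by
    refine (integrable_finsetSum Finset.univ fun j _ => (h1 j).abs).mono' ?_ ?_
    · exact (Measurable.iSup fun j => Finset.measurable_sum _ fun i _ =>
        ((hg j).comp (measurable_pi_apply i)).sub_const _).aestronglyMeasurable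
    · refine Filter.Eventually.of_forall fun y => ?_
      obtain ⟨k, hk⟩ := exists_eq_ciSup_of_finite (f := fun j => ∑ i, (g (y i) j - g (x i) j))
      rw [← hk, Real.norm_eq_abs]
      exact Finset.single_le_sum (f := fun j => |∑ i, (g (y i) j - g (x i) j)|)
        (fun j _ => abs_nonneg _) (Finset.mem_univ k)
  refine ⟨h2, ciSup_le fun j => ?_⟩
  rw [← integral_sum_sub_pi P (hi j)]
  exact integral_mono (h1 j) h2 fun y =>
    le_iSup_of_finite (fun j => ∑ i, (g (y i) j - g (x i) j)) j

lemma lintegral_exp_iSup_swap [Finite ι] (P : Measure Ω) [IsProbabilityMeasure P]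
    {g : Ω → ι → ℝ} (hg : ∀ j, Measurable fun z => g z j) (lam : ℝ) (ε : Fin n → Bool) :
    ∫⁻ w, ENNReal.ofReal (Real.exp (lam * ⨆ j, ∑ i, (g (w i).2 j - g (w i).1 j)))
        ∂(Measure.pi fun _ : Fin n => P.prod P)
      = ∫⁻ w, ENNReal.ofReal (Real.exp (lam * ⨆ j, ∑ i,
          boolSign (ε i) * (g (w i).2 j - g (w i).1 j)))
        ∂(Measure.pi fun _ : Fin n => P.prod P) := by
  have hmp : MeasurePreserving
      (fun (w : Fin n → Ω × Ω) i => (if ε i then id else Prod.swap) (w i))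
      (Measure.pi fun _ : Fin n => P.prod P) (Measure.pi fun _ : Fin n => P.prod P) :=
    measurePreserving_pi _ _ fun i => by
      cases ε i
      · exact Measure.measurePreserving_swap
      · exact MeasurePreserving.id _
  have hm : Measurable fun w : Fin n → Ω × Ω =>
      ENNReal.ofReal (Real.exp (lam * ⨆ j, ∑ i, (g (w i).2 j - g (w i).1 j))) := by
    refine measurable_ofReal_exp (Measurable.const_mul (Measurable.iSup fun j => ?_) lam)
    refine Finset.measurable_sum (f := fun i (w : Fin n → Ω × Ω) =>
      g (w i).2 j - g (w i).1 j) _ fun i _ => ?_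
    exact ((hg j).comp (measurable_snd.comp (measurable_pi_apply i))).sub
      ((hg j).comp (measurable_fst.comp (measurable_pi_apply i)))
  rw [← hmp.lintegral_comp hm]
  refine lintegral_congr fun w => ?_
  congr 3
  refine iSup_congr fun j => Finset.sum_congr rfl fun i _ => ?_
  cases h : ε i <;> simp [boolSign, h]

theorem lintegral_exp_iSup_integral_sub_le [Finite ι] [Nonempty ι] (P : Measure Ω)
    [IsProbabilityMeasure P] {g : Ω → ι → ℝ} (hg : ∀ j, Measurable fun z => g z j)
    (hi : ∀ j, Integrable (fun z => g z j) P) {lam : ℝ} (hlam : 0 ≤ lam) :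
    ∫⁻ x, ENNReal.ofReal (Real.exp (lam * ⨆ j, ∑ i, ((∫ z, g z j ∂P) - g (x i) j)))
        ∂(Measure.pi fun _ : Fin n => P)
      ≤ ∫⁻ x, ENNReal.ofReal ((∑ ε : Fin n → Bool,
          Real.exp (2 * lam * radSup (fun i => g (x i)) ε)) / 2 ^ n)
        ∂(Measure.pi fun _ : Fin n => P) := by
  set μ := Measure.pi fun _ : Fin n => P with hμ
  have hgi : ∀ (j : ι) (i : Fin n), Measurable fun x : Fin n → Ω => g (x i) j := fun j i =>
    (hg j).comp (measurable_pi_apply i)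
  have hD : Measurable fun p : (Fin n → Ω) × (Fin n → Ω) =>
      ⨆ j, ∑ i, (g (p.2 i) j - g (p.1 i) j) :=
    Measurable.iSup fun j => Finset.measurable_sum _ fun i _ =>
      ((hgi j i).comp measurable_snd).sub ((hgi j i).comp measurable_fst)
  have hgv : Measurable fun x : Fin n → Ω => fun i => g (x i) :=
    measurable_pi_iff.2 fun i => measurable_pi_iff.2 fun j => hgi j i
  have hrad : ∀ ε : Fin n → Bool, Measurable fun x : Fin n → Ω =>
      ENNReal.ofReal (Real.exp (2 * lam * radSup (fun i => g (x i)) ε)) := fun ε =>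
    measurable_ofReal_exp (((measurable_radSup ε).comp hgv).const_mul _)
  have hfst : MeasurePreserving (fun (w : Fin n → Ω × Ω) i => (w i).1)
      (Measure.pi fun _ : Fin n => P.prod P) μ :=
    measurePreserving_pi _ _ fun i => measurePreserving_fst
  have hsnd : MeasurePreserving (fun (w : Fin n → Ω × Ω) i => (w i).2)
      (Measure.pi fun _ : Fin n => P.prod P) μ :=
    measurePreserving_pi _ _ fun i => measurePreserving_snd
  set I : (Fin n → Bool) → ℝ≥0∞ := fun ε =>
    ∫⁻ x, ENNReal.ofReal (Real.exp (2 * lam * radSup (fun i => g (x i)) ε)) ∂μ with hI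
  have step1 : ∫⁻ x, ENNReal.ofReal (Real.exp
        (lam * ⨆ j, ∑ i, ((∫ z, g z j ∂P) - g (x i) j))) ∂μ
      ≤ ∫⁻ w, ENNReal.ofReal (Real.exp (lam * ⨆ j, ∑ i, (g (w i).2 j - g (w i).1 j)))
        ∂(Measure.pi fun _ : Fin n => P.prod P) := by
    have e := (measurePreserving_arrowProdEquivProdArrow Ω Ω (Fin n) (fun _ => P)
      (fun _ => P)).lintegral_comp (measurable_ofReal_exp (hD.const_mul lam))
    rw [lintegral_prod _ (measurable_ofReal_exp (hD.const_mul lam)).aemeasurable] at e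
    refine le_trans (lintegral_mono fun x => ?_) e.symm.le
    obtain ⟨h1, h2⟩ := iSup_integral_sub_le (n := n) P hg hi x
    refine le_trans ?_ (ofReal_exp_integral_le _ (h1.const_mul lam))
    rw [integral_const_mul]
    exact ENNReal.ofReal_le_ofReal (Real.exp_le_exp.2 (mul_le_mul_of_nonneg_left h2 hlam))
  have step2 : ∀ ε : Fin n → Bool,
      ∫⁻ w, ENNReal.ofReal (Real.exp (lam * ⨆ j, ∑ i, (g (w i).2 j - g (w i).1 j)))
        ∂(Measure.pi fun _ : Fin n => P.prod P)
      ≤ 2⁻¹ * (I ε + I fun i => !ε i) := fun ε => by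
    rw [lintegral_exp_iSup_swap P hg lam ε]
    calc _ ≤ ∫⁻ w, 2⁻¹ * (ENNReal.ofReal (Real.exp (2 * lam * radSup (fun i => g (w i).2) ε))
            + ENNReal.ofReal (Real.exp (2 * lam * radSup (fun i => g (w i).1) fun i => !ε i)))
          ∂(Measure.pi fun _ : Fin n => P.prod P) := by
          refine lintegral_mono fun w => ?_
          set p := radSup (fun i => g (w i).2) ε with hp
          set q := radSup (fun i => g (w i).1) fun i => !ε i with hq
          have h1 : ⨆ j, ∑ i, boolSign (ε i) * (g (w i).2 j - g (w i).1 j) ≤ p + q :=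
            ciSup_le fun j => by
              have a1 := le_radSup (fun i => g (w i).2) ε j
              have a2 := le_radSup (fun i => g (w i).1) (fun i => !ε i) j
              simp only [boolSign_not, neg_mul, Finset.sum_neg_distrib] at a2
              simp only [mul_sub, Finset.sum_sub_distrib]
              linarith
          have h2 : Real.exp (lam * ⨆ j, ∑ i, boolSign (ε i) * (g (w i).2 j - g (w i).1 j))
              ≤ 2⁻¹ * (Real.exp (2 * lam * p) + Real.exp (2 * lam * q)) := by
            refine (Real.exp_le_exp.2 (mul_le_mul_of_nonneg_left h1 hlam)).trans ?_
            have e1 : Real.exp (lam * (p + q)) = Real.exp (lam * p) * Real.exp (lam * q) := by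
              rw [← Real.exp_add]; ring_nf
            have e2 : Real.exp (2 * lam * p) = Real.exp (lam * p) ^ 2 := by
              rw [← Real.exp_nat_mul]; push_cast; ring_nf
            have e3 : Real.exp (2 * lam * q) = Real.exp (lam * q) ^ 2 := by
              rw [← Real.exp_nat_mul]; push_cast; ring_nf
            rw [e1, e2, e3]
            nlinarith [sq_nonneg (Real.exp (lam * p) - Real.exp (lam * q))]
          refine (ENNReal.ofReal_le_ofReal h2).trans ?_
          rw [ENNReal.ofReal_mul (by norm_num), ENNReal.ofReal_add (Real.exp_pos _).le
            (Real.exp_pos _).le, ENNReal.ofReal_inv_of_pos two_pos]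
          simp
      _ = _ := by
          rw [lintegral_const_mul' _ _ (by simp), lintegral_add_left
            (f := fun w : Fin n → Ω × Ω =>
              ENNReal.ofReal (Real.exp (2 * lam * radSup (fun i => g (w i).2) ε)))
            ((hrad ε).comp hsnd.measurable)]
          congr 2
          · exact hsnd.lintegral_comp (hrad ε)
          · exact hfst.lintegral_comp (hrad _)
  have hinv : Function.Involutive fun ε : Fin n → Bool => fun i => !ε i := fun ε => by simp
  have hcard : (2 : ℝ≥0∞) ^ n * (2 ^ n)⁻¹ = 1 :=
    ENNReal.mul_inv_cancel (by simp) (by simp)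
  refine step1.trans ?_
  set J := ∫⁻ w, ENNReal.ofReal (Real.exp (lam * ⨆ j, ∑ i, (g (w i).2 j - g (w i).1 j)))
    ∂(Measure.pi fun _ : Fin n => P.prod P)
  have h3 : (2 : ℝ≥0∞) ^ n * J ≤ ∑ ε, I ε := by
    calc (2 : ℝ≥0∞) ^ n * J = ∑ _ε : Fin n → Bool, J := by simp
      _ ≤ ∑ ε : Fin n → Bool, 2⁻¹ * (I ε + I fun i => !ε i) :=
          Finset.sum_le_sum fun ε _ => step2 ε
      _ = 2⁻¹ * (∑ ε, I ε + ∑ ε, I ε) := by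
          rw [← Finset.mul_sum, Finset.sum_add_distrib, hinv.bijective.sum_comp I]
      _ = ∑ ε, I ε := by
          rw [← two_mul, ← mul_assoc, ENNReal.inv_mul_cancel (by simp) (by simp), one_mul]
  calc J = (2 ^ n)⁻¹ * (2 ^ n * J) := by
        rw [← mul_assoc, mul_comm _ (2 ^ n), hcard, one_mul]
    _ ≤ (2 ^ n)⁻¹ * ∑ ε, I ε := by gcongr
    _ = ∫⁻ x, (2 ^ n)⁻¹ * ∑ ε, ENNReal.ofReal
          (Real.exp (2 * lam * radSup (fun i => g (x i)) ε)) ∂μ := by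
        rw [lintegral_const_mul' _ _ (by simp), lintegral_finsetSum _ fun ε _ => hrad ε]
    _ = _ := by
        refine lintegral_congr fun x => ?_
        rw [← ENNReal.ofReal_sum_of_nonneg fun _ _ => (Real.exp_pos _).le, div_eq_inv_mul,
          ENNReal.ofReal_mul (by positivity), ENNReal.ofReal_inv_of_pos (by positivity),
          ENNReal.ofReal_pow (by norm_num)]
        simp

end Symmetrization

section Concentration

variable {Ω ι : Type*} [MeasurableSpace Ω] {n : ℕ}

lemma integrable_of_ae_abs_le {P : Measure Ω} [IsFiniteMeasure P] {t : Ω → ι → ℝ} {b : ℝ}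
    (ht : ∀ j, Measurable fun z => t z j) (hb : ∀ᵐ z ∂P, ∀ j, |t z j| ≤ b) (j : ι) :
    Integrable (fun z => t z j) P :=
  Integrable.of_bound (ht j).aestronglyMeasurable b (hb.mono fun _ hz => hz j)

lemma ae_forall_eval {P : Measure Ω} [IsProbabilityMeasure P] {p : Ω → Prop}
    (hp : ∀ᵐ z ∂P, p z) : ∀ᵐ x ∂(Measure.pi fun _ : Fin n => P), ∀ i, p (x i) :=
  ae_all_iff.2 fun i => (measurePreserving_eval (fun _ : Fin n => P) i).quasiMeasurePreserving.ae hp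

lemma integrable_radAvg_pi [Finite ι] [Nonempty ι] {P : Measure Ω} [IsProbabilityMeasure P]
    {t : Ω → ι → ℝ} {b : ℝ} (ht : ∀ j, Measurable fun z => t z j)
    (hb : ∀ᵐ z ∂P, ∀ j, |t z j| ≤ b) :
    Integrable (fun x : Fin n → Ω => radAvg fun i => t (x i)) (Measure.pi fun _ : Fin n => P) := by
  have htv : Measurable fun x : Fin n → Ω => fun i => t (x i) :=
    measurable_pi_iff.2 fun i => measurable_pi_iff.2 fun j => (ht j).comp (measurable_pi_apply i)
  refine Integrable.of_bound (measurable_radAvg.comp htv).aestronglyMeasurable (n * b) ?_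
  filter_upwards [ae_forall_eval hb] with x hx
  rw [Real.norm_of_nonneg (radAvg_nonneg _)]
  exact radAvg_le_of_abs_le hx

lemma integrable_sqSup_pi [Finite ι] [Nonempty ι] {P : Measure Ω} [IsProbabilityMeasure P]
    {t : Ω → ι → ℝ} {b : ℝ} (ht : ∀ j, Measurable fun z => t z j)
    (hb : ∀ᵐ z ∂P, ∀ j, |t z j| ≤ b) :
    Integrable (fun x : Fin n → Ω => sqSup fun i => t (x i)) (Measure.pi fun _ : Fin n => P) := by
  have htv : Measurable fun x : Fin n → Ω => fun i => t (x i) :=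
    measurable_pi_iff.2 fun i => measurable_pi_iff.2 fun j => (ht j).comp (measurable_pi_apply i)
  refine Integrable.of_bound (measurable_sqSup.comp htv).aestronglyMeasurable (n * b ^ 2) ?_
  filter_upwards [ae_forall_eval hb] with x hx
  rw [Real.norm_of_nonneg (sqSup_nonneg _)]
  exact sqSup_le_of_bound hx

theorem lintegral_exp_iSup_le [Finite ι] [Nonempty ι] (P : Measure Ω) [IsProbabilityMeasure P]
    {g t : Ω → ι → ℝ} (hg : ∀ j, Measurable fun z => g z j) (ht : ∀ j, Measurable fun z => t z j)
    (j₀ : ι) (hg0 : ∀ z, g z j₀ = 0) (ht0 : ∀ z, t z j₀ = 0) {b : ℝ}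
    (hb : ∀ᵐ z ∂P, ∀ j, |t z j| ≤ b)
    (hgt : ∀ᵐ z ∂P, ∀ j k, |g z j - g z k| ≤ |t z j - t z k|) {lam : ℝ} (hlam : 0 ≤ lam)
    (hlb : lam * b ≤ 1 / 32) :
    ∫⁻ x, ENNReal.ofReal (Real.exp (lam * ⨆ j, ∑ i, ((∫ z, g z j ∂P) - g (x i) j)))
        ∂(Measure.pi fun _ : Fin n => P)
      ≤ ENNReal.ofReal (Real.exp (4 * lam * (∫ x, radAvg (fun i => t (x i))
            ∂(Measure.pi fun _ : Fin n => P))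
          + 64 * lam ^ 2 * ∫ x, sqSup (fun i => t (x i)) ∂(Measure.pi fun _ : Fin n => P))) := by
  have hgt0 : ∀ᵐ z ∂P, ∀ j, |g z j| ≤ |t z j| := hgt.mono fun z hz j => by
    simpa [hg0, ht0] using hz j j₀
  have hi : ∀ j, Integrable (fun z => g z j) P := integrable_of_ae_abs_le hg <| by
    filter_upwards [hgt0, hb] with z h1 h2 j using (h1 j).trans (h2 j)
  have htv : Measurable t := measurable_pi_iff.2 ht
  have htv' : Measurable fun x : Fin n → Ω => fun i => t (x i) :=
    measurable_pi_iff.2 fun i => htv.comp (measurable_pi_apply i)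
  have hb0 : 0 ≤ b := by
    obtain ⟨z, hz⟩ := hb.exists
    exact (abs_nonneg _).trans (hz j₀)
  have hprob : IsProbabilityMeasure (P.map t) := Measure.isProbabilityMeasure_map htv.aemeasurable
  have hmap : (Measure.pi fun _ : Fin n => P).map (fun x i => t (x i))
      = Measure.pi fun _ : Fin n => P.map t :=
    Measure.pi_map_pi (μ := fun _ : Fin n => P) (f := fun _ => t) fun _ => htv.aemeasurable
  have hset : MeasurableSet {v : ι → ℝ | ∀ j, |v j| ≤ b} := by
    cases nonempty_fintype ι
    rw [Set.ofPred_forall]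
    exact MeasurableSet.iInter fun j =>
      measurableSet_le (measurable_pi_apply j).abs measurable_const
  have hb' : ∀ᵐ v ∂(P.map t), ∀ j, |v j| ≤ b := (ae_map_iff htv.aemeasurable hset).2 hb
  have hmain := lintegral_exp_half_le (n := n) (P.map t) hb' (s := 4 * lam) (q := 64 * lam ^ 2)
    (by positivity) (by positivity) (by nlinarith [mul_nonneg hlam hb0])
  rw [← hmap, lintegral_map (by
      exact measurable_ofReal_exp (((measurable_radAvg.const_mul _).add
        (measurable_sqSup.const_mul _)).div_const _)) htv',
    integral_map htv'.aemeasurable (by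
      exact ((measurable_radAvg.const_mul _).add
        (measurable_sqSup.const_mul _)).aestronglyMeasurable),
    integral_add ((integrable_radAvg_pi ht hb).const_mul _)
      ((integrable_sqSup_pi ht hb).const_mul _), integral_const_mul, integral_const_mul] at hmain
  refine (lintegral_exp_iSup_integral_sub_le P hg hi hlam).trans (le_trans ?_ hmain)
  refine lintegral_mono_ae ?_
  filter_upwards [ae_forall_eval hgt, ae_forall_eval hgt0] with x h1 h2
  refine ENNReal.ofReal_le_ofReal ((sum_exp_radSup_le (fun i => g (x i)) j₀ (fun i => hg0 _)
    (by positivity)).trans (Real.exp_le_exp.2 ?_))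
  have a1 := radAvg_le_of_contraction (g := fun i => g (x i)) (t := fun i => t (x i)) h1
  have a2 := sqSup_le_of_abs_le (g := fun i => g (x i)) (t := fun i => t (x i)) h2
  nlinarith [mul_le_mul_of_nonneg_left a1 hlam, mul_le_mul_of_nonneg_left a2 (sq_nonneg lam)]

theorem integral_sqSup_le [Finite ι] [Nonempty ι] (P : Measure Ω) [IsProbabilityMeasure P]
    {t : Ω → ι → ℝ} (ht : ∀ j, Measurable fun z => t z j)
    (j₀ : ι) (ht0 : ∀ z, t z j₀ = 0) {b u : ℝ} (hb0 : 0 < b)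
    (hb : ∀ᵐ z ∂P, ∀ j, |t z j| ≤ b) (hu : ∀ j, ∫ z, t z j ^ 2 ∂P ≤ u ^ 2) :
    ∫ x, sqSup (fun i => t (x i)) ∂(Measure.pi fun _ : Fin n => P)
      ≤ 2 * n * u ^ 2 + 16 * b * ∫ x, radAvg (fun i => t (x i))
          ∂(Measure.pi fun _ : Fin n => P) := by
  set A := ∫ x, radAvg (fun i => t (x i)) ∂(Measure.pi fun _ : Fin n => P)
  set W := ∫ x, sqSup (fun i => t (x i)) ∂(Measure.pi fun _ : Fin n => P) with hW
  set g : Ω → ι → ℝ := fun z j => -(t z j ^ 2 / (2 * b)) with hgdef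
  have hg : ∀ j, Measurable fun z => g z j := fun j => (((ht j).pow_const 2).div_const _).neg
  have hgt : ∀ᵐ z ∂P, ∀ j k, |g z j - g z k| ≤ |t z j - t z k| := by
    filter_upwards [hb] with z hz j k
    have e : g z j - g z k = -((t z j + t z k) / (2 * b)) * (t z j - t z k) := by
      simp only [hgdef]; field_simp; ring
    rw [e, abs_mul, abs_neg, abs_div, abs_of_pos (by positivity : 0 < 2 * b)]
    refine mul_le_of_le_one_left (abs_nonneg _) ((div_le_one (by positivity)).2 ?_)
    linarith [abs_add_le (t z j) (t z k), hz j, hz k]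
  have h1 := lintegral_exp_iSup_le (n := n) P hg ht j₀ (by simp [hgdef, ht0]) ht0 hb hgt
    (lam := 1 / (256 * b)) (by positivity) (by rw [div_mul_eq_mul_div]; field_simp; norm_num)
  have hlow : ∀ x : Fin n → Ω, (sqSup (fun i => t (x i)) - n * u ^ 2) / (2 * b)
      ≤ ⨆ j, ∑ i, ((∫ z, g z j ∂P) - g (x i) j) := fun x => by
    obtain ⟨j, hj⟩ := exists_eq_ciSup_of_finite (f := fun j => ∑ i, t (x i) j ^ 2)
    refine le_trans ?_ (le_iSup_of_finite (fun j => ∑ i, ((∫ z, g z j ∂P) - g (x i) j)) j)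
    have e : ∑ i, ((∫ z, g z j ∂P) - g (x i) j)
        = (sqSup (fun i => t (x i)) - n * ∫ z, t z j ^ 2 ∂P) / (2 * b) := by
      rw [sqSup, ← hj]
      simp only [hgdef, integral_neg, integral_div, Finset.sum_sub_distrib, Finset.sum_neg_distrib,
        ← Finset.sum_div, Finset.sum_const, Finset.card_univ, Fintype.card_fin, nsmul_eq_mul]
      ring
    rw [e]
    gcongr
    exact hu j
  have hWi : Integrable (fun x : Fin n → Ω => sqSup fun i => t (x i))
      (Measure.pi fun _ : Fin n => P) := integrable_sqSup_pi ht hb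
  have hUi : Integrable (fun x : Fin n → Ω => 1 / (256 * b)
      * ((sqSup (fun i => t (x i)) - n * u ^ 2) / (2 * b))) (Measure.pi fun _ : Fin n => P) :=
    ((hWi.sub (integrable_const _)).div_const _).const_mul _
  have h2 := (ofReal_exp_integral_le _ hUi).trans (le_trans (lintegral_mono fun x =>
    ENNReal.ofReal_le_ofReal (Real.exp_le_exp.2
      (mul_le_mul_of_nonneg_left (hlow x) (by positivity)))) h1)
  rw [ENNReal.ofReal_le_ofReal_iff (Real.exp_pos _).le, Real.exp_le_exp, integral_const_mul,
    integral_div, integral_sub hWi (integrable_const _), ← hW] at h2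
  simp only [integral_const, probReal_univ, smul_eq_mul, one_mul] at h2
  have e1 : 1 / (256 * b) * ((W - n * u ^ 2) / (2 * b)) = (W - n * u ^ 2) / (512 * b ^ 2) := by
    field_simp; ring
  have e2 : 4 * (1 / (256 * b)) * A + 64 * (1 / (256 * b)) ^ 2 * W
      = (8 * b * A + W / 2) / (512 * b ^ 2) := by
    field_simp; ring
  rw [e1, e2, div_le_div_iff_of_pos_right (by positivity)] at h2
  linarith

theorem measure_iSup_gt_le [Finite ι] [Nonempty ι] (P : Measure Ω) [IsProbabilityMeasure P]
    {g t : Ω → ι → ℝ} (hg : ∀ j, Measurable fun z => g z j) (ht : ∀ j, Measurable fun z => t z j)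
    (j₀ : ι) (hg0 : ∀ z, g z j₀ = 0) (ht0 : ∀ z, t z j₀ = 0) {b u r : ℝ} (hb0 : 0 < b)
    (hr0 : 0 < r) (hru : r ≤ u)
    (hb : ∀ᵐ z ∂P, ∀ j, |t z j| ≤ b)
    (hgt : ∀ᵐ z ∂P, ∀ j k, |g z j - g z k| ≤ |t z j - t z k|)
    (hu : ∀ j, ∫ z, t z j ^ 2 ∂P ≤ u ^ 2)
    (hA : ∫ x, radAvg (fun i => t (x i)) ∂(Measure.pi fun _ : Fin n => P)
      ≤ n * (u * r / (32 * b))) :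
    (Measure.pi fun _ : Fin n => P) {x | ∃ j, n * (2 * r * u / b)
        < ∑ i, ((∫ z, g z j ∂P) - g (x i) j)}
      ≤ ENNReal.ofReal (Real.exp (-(n * r ^ 2 / (200 * b ^ 2)))) := by
  have hu0 : 0 < u := hr0.trans_le hru
  set A := ∫ x, radAvg (fun i => t (x i)) ∂(Measure.pi fun _ : Fin n => P)
  set μ := Measure.pi fun _ : Fin n => P
  have hW := integral_sqSup_le (n := n) P ht j₀ ht0 hb0 hb hu
  set W := ∫ x, sqSup (fun i => t (x i)) ∂(Measure.pi fun _ : Fin n => P)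
  set lam := r / (160 * b * u) with hlam
  have hlam0 : 0 < lam := by positivity
  have h1 := lintegral_exp_iSup_le (n := n) P hg ht j₀ hg0 ht0 hb hgt hlam0.le (by
    rw [hlam, div_mul_eq_mul_div, div_le_iff₀ (by positivity)]
    nlinarith)
  have hW2 : W ≤ 5 / 2 * n * u ^ 2 := by
    have : 16 * b * A ≤ 1 / 2 * n * u ^ 2 := by
      calc 16 * b * A ≤ 16 * b * (n * (u * r / (32 * b))) := by gcongr
        _ = 1 / 2 * n * (u * r) := by field_simp; ring
        _ ≤ 1 / 2 * n * u ^ 2 := by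
          rw [sq]; gcongr
    linarith
  have hmeas : Measurable fun x : Fin n → Ω => ENNReal.ofReal (Real.exp
      (lam * ⨆ j, ∑ i, ((∫ z, g z j ∂P) - g (x i) j))) :=
    measurable_ofReal_exp (Measurable.const_mul (Measurable.iSup fun j =>
      Finset.measurable_sum _ fun i _ =>
        ((hg j).comp (measurable_pi_apply i)).const_sub _) lam)
  have hmk := mul_meas_ge_le_lintegral (μ := μ) hmeas
    (ENNReal.ofReal (Real.exp (lam * (n * (2 * r * u / b)))))
  have hsub : {x : Fin n → Ω | ∃ j, n * (2 * r * u / b) < ∑ i, ((∫ z, g z j ∂P) - g (x i) j)}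
      ⊆ {x | ENNReal.ofReal (Real.exp (lam * (n * (2 * r * u / b))))
        ≤ ENNReal.ofReal (Real.exp (lam * ⨆ j, ∑ i, ((∫ z, g z j ∂P) - g (x i) j)))} := by
    rintro x ⟨j, hj⟩
    refine ENNReal.ofReal_le_ofReal (Real.exp_le_exp.2 (mul_le_mul_of_nonneg_left ?_ hlam0.le))
    exact hj.le.trans (le_iSup_of_finite (fun j => ∑ i, ((∫ z, g z j ∂P) - g (x i) j)) j)
  refine (measure_mono hsub).trans ?_
  have h2 := hmk.trans h1
  rw [mul_comm, ← ENNReal.le_div_iff_mul_le (Or.inl (by simp [Real.exp_pos])) (Or.inl (by simp)),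
    ← ENNReal.ofReal_div_of_pos (Real.exp_pos _), ← Real.exp_sub] at h2
  refine h2.trans (ENNReal.ofReal_le_ofReal (Real.exp_le_exp.2 ?_))
  have b1 : 4 * lam * A ≤ 4 * lam * (n * (u * r / (32 * b))) := by gcongr
  have b2 : 64 * lam ^ 2 * W ≤ 64 * lam ^ 2 * (5 / 2 * n * u ^ 2) := by gcongr
  have e1 : 4 * lam * (n * (u * r / (32 * b))) = n * r ^ 2 / b ^ 2 * (1 / 1280) := by
    rw [hlam]; field_simp; ring
  have e2 : 64 * lam ^ 2 * (5 / 2 * n * u ^ 2) = n * r ^ 2 / b ^ 2 * (1 / 160) := by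
    rw [hlam]; field_simp; ring
  have e3 : lam * (n * (2 * r * u / b)) = n * r ^ 2 / b ^ 2 * (1 / 80) := by
    rw [hlam]; field_simp; ring
  have e4 : n * r ^ 2 / (200 * b ^ 2) = n * r ^ 2 / b ^ 2 * (1 / 200) := by
    field_simp
  have hpos : 0 ≤ n * r ^ 2 / b ^ 2 := by positivity
  rw [e1] at b1; rw [e2] at b2; rw [e3, e4]
  linarith

end Concentration

section LocalizedClass

lemma ofReal_radAvg_le_locRad {α ι : Type*} [MeasurableSpace α] [Finite ι] [Nonempty ι]
    (ν : Measure α) (G : Set (α → ℝ)) {n : ℕ} (x : Fin n → α) (r : ℝ) (v : Fin n → ι → ℝ)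
    {c : ℝ} (hc : 0 ≤ c) (j₀ : ι) (h0 : ∀ i, v i j₀ = 0)
    (h : ∀ j, j ≠ j₀ → ∃ g ∈ G, Real.sqrt (∫ a, g a ^ 2 ∂ν) ≤ r ∧ ∀ i, c * v i j = g (x i)) :
    ENNReal.ofReal (c / n * radAvg v) ≤ locRad ν G x r := by
  have hsup : ∀ ε : Fin n → Bool, 0 ≤ radSup v ε := fun ε => by
    simpa [h0] using le_radSup v ε j₀
  have e : c / n * radAvg v = (∑ ε : Fin n → Bool, c / n * radSup v ε) / 2 ^ n := by
    rw [radAvg, ← Finset.mul_sum, mul_div_assoc]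
  rw [e, ENNReal.ofReal_div_of_pos (by positivity),
    ENNReal.ofReal_sum_of_nonneg fun ε _ => mul_nonneg (by positivity) (hsup ε),
    ENNReal.ofReal_pow (by norm_num), ENNReal.ofReal_ofNat, locRad]
  gcongr with ε
  obtain ⟨j, hj⟩ := exists_eq_ciSup_of_finite (f := fun j => ∑ i, boolSign (ε i) * v i j)
  rw [radSup, ← hj]
  by_cases hjj : j = j₀
  · simp [hjj, h0]
  · obtain ⟨g, hg, hgr, hgv⟩ := h j hjj
    refine le_trans ?_ (le_iSup₂_of_le g ⟨hg, hgr⟩ le_rfl)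
    refine ENNReal.ofReal_le_ofReal (le_trans (le_of_eq ?_) (le_abs_self _))
    simp only [← hgv, Finset.mul_sum]
    refine Finset.sum_congr rfl fun i _ => ?_
    rw [boolSign]
    ring

/-- The difference of losses `ℓ (f x - y) - ℓ (f₀ x - y)` at a sample `z = (x, y)`. -/
noncomputable def lossDiff {α : Type*} (ℓ : ℝ → ℝ) (f f₀ : α → ℝ) (z : α × ℝ) : ℝ :=
  ℓ (f z.1 - z.2) - ℓ (f₀ z.1 - z.2)

/-- The class of multiples `a (f - f₀)` with `a ∈ [0, 1]` and `f ∈ F`. -/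
def starClass {α : Type*} (F : Set (α → ℝ)) (f₀ : α → ℝ) : Set (α → ℝ) :=
  {h | ∃ a : ℝ, 0 ≤ a ∧ a ≤ 1 ∧ ∃ f ∈ F, h = fun t => a * (f t - f₀ t)}

variable {α : Type*} [MeasurableSpace α] {n : ℕ}

theorem measure_exists_lossDiff_gt_le_of_finite {κ : Type*} [Finite κ] (P : Measure (α × ℝ))
    [IsProbabilityMeasure P] {ℓ : ℝ → ℝ} {L : ℝ} (hL : 0 < L)
    (hℓ : ∀ a b, |ℓ a - ℓ b| ≤ L * |a - b|) {F : Set (α → ℝ)} {f₀ : α → ℝ}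
    (hf₀ : Measurable f₀) {M r u : ℝ} (hM : 0 < M) (hr : 0 < r) (hru : r ≤ u)
    (hb₀ : ∀ᵐ z ∂P, |f₀ z.1| ≤ M)
    (hE : ∫⁻ ω, locRad (P.map Prod.fst) (starClass F f₀) (fun i : Fin n => (ω i).1) r
      ∂(Measure.pi fun _ : Fin n => P) ≤ ENNReal.ofReal (r ^ 2 / (64 * M)))
    (hn : 1 ≤ n) (f : κ → α → ℝ) (hfF : ∀ k, f k ∈ F) (hf : ∀ k, Measurable (f k))
    (hb : ∀ k, ∀ᵐ z ∂P, |f k z.1| ≤ M)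
    (hu : ∀ k, Real.sqrt (∫ x, (f k x - f₀ x) ^ 2 ∂(P.map Prod.fst)) ≤ u) :
    (Measure.pi fun _ : Fin n => P) {ω | ∃ k, n * (L * (r * u / M))
        < ∑ i, ((∫ z, lossDiff ℓ (f k) f₀ z ∂P) - lossDiff ℓ (f k) f₀ (ω i))}
      ≤ ENNReal.ofReal (Real.exp (-(n * r ^ 2 / (800 * M ^ 2)))) := by
  have hu0 : 0 < u := hr.trans_le hru
  have hn0 : (0 : ℝ) < n := by exact_mod_cast hn
  have hℓc : Continuous ℓ := (LipschitzWith.of_dist_le_mul (K := ⟨L, hL.le⟩) hℓ).continuous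
  set F' : Option κ → α → ℝ := fun j => j.elim f₀ f with hF'
  have hF'm : ∀ j, Measurable (F' j) := fun j => by
    cases j
    · exact hf₀
    · exact hf _
  set t : α × ℝ → Option κ → ℝ := fun z j => F' j z.1 - f₀ z.1 with ht
  set g : α × ℝ → Option κ → ℝ := fun z j => lossDiff ℓ (F' j) f₀ z / L with hg
  have htm : ∀ j, Measurable fun z => t z j := fun j =>
    ((hF'm j).comp measurable_fst).sub (hf₀.comp measurable_fst)
  have hgm : ∀ j, Measurable fun z => g z j := fun j =>
    ((hℓc.measurable.comp (((hF'm j).comp measurable_fst).sub measurable_snd)).sub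
      (hℓc.measurable.comp ((hf₀.comp measurable_fst).sub measurable_snd))).div_const L
  have ht0 : ∀ z, t z none = 0 := fun z => by simp [ht, hF']
  have hg0 : ∀ z, g z none = 0 := fun z => by simp [hg, hF', lossDiff]
  have htb : ∀ᵐ z ∂P, ∀ j, |t z j| ≤ 2 * M := by
    filter_upwards [hb₀, ae_all_iff.2 hb] with z h1 h2 j
    cases j with
    | none => rw [ht0]; simpa using hM.le
    | some k =>
      refine (abs_sub (f k z.1) (f₀ z.1)).trans ?_
      linarith [h2 k]
  have hgt : ∀ᵐ z ∂P, ∀ j k, |g z j - g z k| ≤ |t z j - t z k| :=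
    Filter.Eventually.of_forall fun z j k => by
      have e1 : g z j - g z k = (ℓ (F' j z.1 - z.2) - ℓ (F' k z.1 - z.2)) / L := by
        simp only [hg, lossDiff]; ring
      have e2 : t z j - t z k = (F' j z.1 - z.2) - (F' k z.1 - z.2) := by
        simp only [ht]; ring
      rw [e1, e2, abs_div, abs_of_pos hL, div_le_iff₀ hL, mul_comm]
      exact hℓ _ _
  have hnorm : ∀ k, ∫ x, (f k x - f₀ x) ^ 2 ∂(P.map Prod.fst) ≤ u ^ 2 := fun k =>
    (Real.sqrt_le_iff.1 (hu k)).2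
  have htu : ∀ j, ∫ z, t z j ^ 2 ∂P ≤ u ^ 2 := fun j => by
    cases j with
    | none => simpa [ht0] using sq_nonneg u
    | some k =>
      have := hnorm k
      rwa [integral_map (f := fun x => (f k x - f₀ x) ^ 2) measurable_fst.aemeasurable
        (((hf k).sub hf₀).pow_const 2).aestronglyMeasurable] at this
  have hA : ∫ ω, radAvg (fun i => t (ω i)) ∂(Measure.pi fun _ : Fin n => P)
      ≤ n * (u * r / (32 * (2 * M))) := by
    have h1 : ENNReal.ofReal (∫ ω, r / u / n * radAvg (fun i => t (ω i))
        ∂(Measure.pi fun _ : Fin n => P)) ≤ ENNReal.ofReal (r ^ 2 / (64 * M)) := by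
      rw [ofReal_integral_eq_lintegral_ofReal ((integrable_radAvg_pi htm htb).const_mul _)
        (Filter.Eventually.of_forall fun ω => mul_nonneg (by positivity) (radAvg_nonneg _))]
      refine le_trans (lintegral_mono fun ω => ?_) hE
      refine ofReal_radAvg_le_locRad _ _ (fun i => (ω i).1) r (fun i => t (ω i)) (by positivity)
        none (fun i => ht0 _) fun j hj => ?_
      obtain ⟨k, rfl⟩ := Option.ne_none_iff_exists'.1 hj
      refine ⟨fun x => r / u * (f k x - f₀ x),
        ⟨r / u, by positivity, (div_le_one hu0).2 hru, f k, hfF k, rfl⟩, ?_, fun i => rfl⟩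
      refine Real.sqrt_le_iff.2 ⟨hr.le, ?_⟩
      simp only [mul_pow]
      rw [integral_const_mul]
      calc (r / u) ^ 2 * ∫ x, (f k x - f₀ x) ^ 2 ∂(P.map Prod.fst) ≤ (r / u) ^ 2 * u ^ 2 := by
            gcongr
            exact hnorm k
        _ = r ^ 2 := by field_simp
    rw [ENNReal.ofReal_le_ofReal_iff (by positivity), integral_const_mul] at h1
    have e : n * (u * r / (32 * (2 * M))) = r ^ 2 / (64 * M) / (r / u / n) := by
      field_simp; norm_num
    rw [e, le_div_iff₀ (by positivity), mul_comm]
    exact h1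
  have key := measure_iSup_gt_le (n := n) P hgm htm none hg0 ht0 (b := 2 * M) (by positivity) hr
    hru htb hgt htu hA
  refine (measure_mono ?_).trans (key.trans (le_of_eq ?_))
  · rintro ω ⟨k, hk⟩
    refine ⟨some k, ?_⟩
    have e : ∑ i, ((∫ z, g z (some k) ∂P) - g (ω i) (some k))
        = (∑ i, ((∫ z, lossDiff ℓ (f k) f₀ z ∂P) - lossDiff ℓ (f k) f₀ (ω i))) / L := by
      simp only [hg, hF', integral_div, Option.elim_some, ← sub_div, ← Finset.sum_div]
    rw [e, lt_div_iff₀ hL]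
    refine lt_of_eq_of_lt ?_ hk
    field_simp
  · congr 3
    ring

theorem measure_exists_lossDiff_gt_le (P : Measure (α × ℝ))
    [IsProbabilityMeasure P] {ℓ : ℝ → ℝ} {L : ℝ} (hL : 0 < L)
    (hℓ : ∀ a b, |ℓ a - ℓ b| ≤ L * |a - b|) {F : Set (α → ℝ)} {f₀ : α → ℝ}
    (hf₀ : Measurable f₀) {M r u : ℝ} (hM : 0 < M) (hr : 0 < r) (hru : r ≤ u)
    (hb₀ : ∀ᵐ z ∂P, |f₀ z.1| ≤ M)
    (hE : ∫⁻ ω, locRad (P.map Prod.fst) (starClass F f₀) (fun i : Fin n => (ω i).1) r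
      ∂(Measure.pi fun _ : Fin n => P) ≤ ENNReal.ofReal (r ^ 2 / (64 * M)))
    (hn : 1 ≤ n) (hF : F.Countable) (hf : ∀ f ∈ F, Measurable f)
    (hb : ∀ f ∈ F, ∀ᵐ z ∂P, |f z.1| ≤ M) :
    (Measure.pi fun _ : Fin n => P) {ω | ∃ f ∈ F,
        Real.sqrt (∫ x, (f x - f₀ x) ^ 2 ∂(P.map Prod.fst)) ≤ u ∧ n * (L * (r * u / M))
        < ∑ i, ((∫ z, lossDiff ℓ f f₀ z ∂P) - lossDiff ℓ f f₀ (ω i))}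
      ≤ ENNReal.ofReal (Real.exp (-(n * r ^ 2 / (800 * M ^ 2)))) := by
  set D : Set (α → ℝ) :=
    {f ∈ F | Real.sqrt (∫ x, (f x - f₀ x) ^ 2 ∂(P.map Prod.fst)) ≤ u} with hD
  set B : (α → ℝ) → Set (Fin n → α × ℝ) := fun f => {ω | n * (L * (r * u / M))
        < ∑ i, ((∫ z, lossDiff ℓ f f₀ z ∂P) - lossDiff ℓ f f₀ (ω i))} with hB
  have hset : {ω : Fin n → α × ℝ | ∃ f ∈ F,
        Real.sqrt (∫ x, (f x - f₀ x) ^ 2 ∂(P.map Prod.fst)) ≤ u ∧ n * (L * (r * u / M))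
        < ∑ i, ((∫ z, lossDiff ℓ f f₀ z ∂P) - lossDiff ℓ f f₀ (ω i))} = ⋃ f ∈ D, B f := by
    ext ω
    simp [hD, hB, and_assoc]
  rw [hset]
  rcases D.eq_empty_or_nonempty with h | h
  · simp [h]
  have hDc : D.Countable := hF.mono (Set.sep_subset _ _)
  obtain ⟨e, he⟩ := hDc.exists_eq_range h
  rw [he, Set.biUnion_range, measure_iUnion_eq_iSup_accumulate]
  refine iSup_le fun N => ?_
  have heD : ∀ k, e k ∈ D := fun k => he ▸ Set.mem_range_self k
  refine (measure_mono ?_).trans (measure_exists_lossDiff_gt_le_of_finite P hL hℓ hf₀ hM hr hru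
    hb₀ hE hn (fun k : Fin (N + 1) => e k) (fun k => (heD k).1) (fun k => hf _ (heD k).1)
    (fun k => hb _ (heD k).1) fun k => (heD k).2)
  intro ω hω
  obtain ⟨k, hk, h1⟩ := Set.mem_accumulate.1 hω
  exact ⟨⟨k, Nat.lt_succ_of_le hk⟩, h1⟩

end LocalizedClass

section Peeling

lemma two_mul_add_three_le_pow {l : ℝ} (hl : 1.05 ≤ l) : 2 * l + 3 ≤ l ^ 100 := by
  have h := one_add_mul_le_pow (a := l - 1) (by linarith) 99
  rw [add_sub_cancel] at h
  have h5 : 5 ≤ l ^ 99 := by push_cast at h; linarith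
  calc 2 * l + 3 ≤ 5 * l := by linarith
    _ ≤ l ^ 99 * l := by gcongr
    _ = l ^ 100 := by ring

lemma log_ge_of_three_le {x : ℝ} (hx : 3 ≤ x) : 1.05 ≤ Real.log x := by
  rw [Real.le_log_iff_exp_le (by linarith)]
  refine le_trans ?_ hx
  have h1 := Real.exp_one_lt_d9
  have h2 := Real.add_one_le_exp (-0.05 : ℝ)
  have h3 : Real.exp 1 = Real.exp 1.05 * Real.exp (-0.05) := by
    rw [← Real.exp_add]; norm_num
  nlinarith [Real.exp_pos 1.05]

lemma le_two_pow_ceil {x : ℝ} (hx : 0 < x) : x ≤ 2 ^ ⌈2 * Real.log x⌉₊ := by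
  have h2 : Real.exp (1 / 2) ≤ 2 := by
    have h := Real.exp_one_lt_d9
    have h3 : Real.exp 1 = Real.exp (1 / 2) ^ 2 := by
      rw [← Real.exp_nat_mul]; norm_num
    nlinarith [Real.exp_pos (1 / 2)]
  calc x = Real.exp (Real.log x) := (Real.exp_log hx).symm
    _ ≤ Real.exp (⌈2 * Real.log x⌉₊ * (1 / 2)) := by
        gcongr
        have := Nat.le_ceil (2 * Real.log x)
        linarith
    _ = Real.exp (1 / 2) ^ ⌈2 * Real.log x⌉₊ := Real.exp_nat_mul _ _
    _ ≤ _ := by gcongr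

/-- A value `s ≤ 2 ^ K * r` lies below a dyadic multiple of `r` comparable to `s + r`. -/
lemma exists_two_pow_mul_ge {s r : ℝ} {K : ℕ} (hs : 0 ≤ s) (hr : 0 < r) (h : s ≤ 2 ^ K * r) :
    ∃ k ≤ K, s ≤ 2 ^ k * r ∧ 2 ^ k * r ≤ 2 * (s + r) := by
  induction K with
  | zero => exact ⟨0, le_rfl, h, by linarith⟩
  | succ K ih =>
    by_cases hK : s ≤ 2 ^ K * r
    · obtain ⟨k, hk, h1⟩ := ih hK
      exact ⟨k, by omega, h1⟩
    · refine ⟨K + 1, le_rfl, h, ?_⟩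
      rw [pow_succ]
      linarith

lemma sqrt_integral_map_fst_sq_sub_le {α : Type*} [MeasurableSpace α] (P : Measure (α × ℝ))
    [IsProbabilityMeasure P] {f f₀ : α → ℝ} (hf : Measurable f) (hf₀ : Measurable f₀) {M : ℝ}
    (hM : 0 ≤ M) (hb : ∀ᵐ z ∂P, |f z.1| ≤ M) (hb₀ : ∀ᵐ z ∂P, |f₀ z.1| ≤ M) :
    Real.sqrt (∫ x, (f x - f₀ x) ^ 2 ∂(P.map Prod.fst)) ≤ 2 * M := by
  rw [integral_map (f := fun x => (f x - f₀ x) ^ 2) measurable_fst.aemeasurable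
        ((hf.sub hf₀).pow_const 2).aestronglyMeasurable]
  refine Real.sqrt_le_iff.2 ⟨by positivity, ?_⟩
  have h : ∀ᵐ z ∂P, ‖(f z.1 - f₀ z.1) ^ 2‖ ≤ (2 * M) ^ 2 := by
    filter_upwards [hb, hb₀] with z h1 h2
    rw [norm_pow, Real.norm_eq_abs]
    gcongr
    refine (abs_sub (f z.1) (f₀ z.1)).trans (by linarith)
  have := norm_integral_le_of_norm_le_const h
  rw [probReal_univ, mul_one] at this
  exact (le_abs_self _).trans this

end Peeling

/-- Uniform localized concentration bound: with `r` the critical radius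
solving `E[R̄_n(r; F*)] = r²/(64M)` for the star-shaped shifted class
`F* = {a(f − f₀) : a ∈ [0,1], f ∈ F}`, with probability at least
`1 − 2exp(−b₁nr²/(2M²) + b₂ log log(M/r))` every `f ∈ F` satisfies
`|H_n(f)| ≤ 2‖ℓ‖_Lip M⁻¹ r (‖f − f₀‖₂ + r)`. -/
theorem stmt17 :
    ∃ b₁ b₂ : ℝ, 0 < b₁ ∧ 0 < b₂ ∧
      ∀ (d : ℕ) (X : Set (Fin d → ℝ)) (ℓ : ℝ → ℝ) (Lip : ℝ), 0 ≤ Lip →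
        LipschitzWith (Real.toNNReal Lip) ℓ →
      ∀ P : Measure ((Fin d → ℝ) × ℝ), IsProbabilityMeasure P →
        (∀ᵐ z ∂P, z.1 ∈ X) →
      ∀ n : ℕ, 1 ≤ n →
      ∀ M : ℝ, 0 < M →
      ∀ F : Set ((Fin d → ℝ) → ℝ), F.Countable → (∀ f ∈ F, Measurable f) →
        (∀ f ∈ F, ∀ x ∈ X, |f x| ≤ M) →
      ∀ f₀ : (Fin d → ℝ) → ℝ, Measurable f₀ → (∀ x ∈ X, |f₀ x| ≤ M) →
      ∀ r : ℝ, 0 < r → r ≤ M / 3 →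
        (∫⁻ ω, locRad (P.map Prod.fst)
            { h | ∃ a : ℝ, 0 ≤ a ∧ a ≤ 1 ∧ ∃ f ∈ F, h = fun t => a * (f t - f₀ t) }
            (fun i : Fin n => (ω i).1) r ∂(Measure.pi fun _ : Fin n => P))
          = ENNReal.ofReal (r ^ 2 / (64 * M)) →
        ENNReal.ofReal (1 - 2 * Real.exp (-(b₁ * n * r ^ 2) / (2 * M ^ 2)
            + b₂ * Real.log (Real.log (M / r))))
          ≤ (Measure.pi fun _ : Fin n => P)
              { ω : Fin n → (Fin d → ℝ) × ℝ | ∀ f ∈ F,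
                |(∫ z, (ℓ (f z.1 - z.2) - ℓ (f₀ z.1 - z.2)) ∂P)
                    - (n : ℝ)⁻¹ * ∑ i, (ℓ (f (ω i).1 - (ω i).2) - ℓ (f₀ (ω i).1 - (ω i).2))|
                  ≤ 2 * Lip * M⁻¹ * r
                      * (Real.sqrt (∫ x, (f x - f₀ x) ^ 2 ∂(P.map Prod.fst)) + r) } := by
  refine ⟨1 / 400, 100, by norm_num, by norm_num, ?_⟩
  intro d X ℓ Lip hLip hℓ P hP hX n hn M hM F hF hFm hFb f₀ hf₀ hf₀b r hr hrM hE
  have hℓ' : ∀ a b, |ℓ a - ℓ b| ≤ Lip * |a - b| := fun a b => by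
    simpa [Real.dist_eq, Real.coe_toNNReal _ hLip] using hℓ.dist_le_mul a b
  set S : Set (Fin n → (Fin d → ℝ) × ℝ) := { ω | ∀ f ∈ F,
    |(∫ z, (ℓ (f z.1 - z.2) - ℓ (f₀ z.1 - z.2)) ∂P)
        - (n : ℝ)⁻¹ * ∑ i, (ℓ (f (ω i).1 - (ω i).2) - ℓ (f₀ (ω i).1 - (ω i).2))|
      ≤ 2 * Lip * M⁻¹ * r * (Real.sqrt (∫ x, (f x - f₀ x) ^ 2 ∂(P.map Prod.fst)) + r) } with hS
  rcases hLip.eq_or_lt with rfl | hLip0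
  · have hc : ∀ a b, ℓ a - ℓ b = 0 := fun a b => by simpa using hℓ' a b
    have : S = Set.univ := by
      ext ω
      simp [hS, hc]
    rw [this, measure_univ]
    refine ENNReal.ofReal_le_one.2 ?_
    linarith [Real.exp_pos (-(1 / 400 * n * r ^ 2) / (2 * M ^ 2)
      + 100 * Real.log (Real.log (M / r)))]
  have hn0 : (0 : ℝ) < n := by exact_mod_cast hn
  have hb₀ : ∀ᵐ z ∂P, |f₀ z.1| ≤ M := hX.mono fun z hz => hf₀b _ hz
  have hb : ∀ f ∈ F, ∀ᵐ z ∂P, |f z.1| ≤ M := fun f hf => hX.mono fun z hz => hFb f hf _ hz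
  set l := Real.log (M / r) with hl
  have h3 : 3 ≤ M / r := by rw [le_div_iff₀ hr]; linarith
  have hl1 : 1.05 ≤ l := log_ge_of_three_le h3
  set m := ⌈2 * l⌉₊ with hm
  have hm2 : 2 * M ≤ 2 ^ (m + 1) * r := by
    have h := le_two_pow_ceil (x := M / r) (by positivity)
    rw [div_le_iff₀ hr] at h
    rw [pow_succ]
    linarith
  set q := Real.exp (-(n * r ^ 2 / (800 * M ^ 2))) with hq
  set B : (ℝ → ℝ) → ℕ → Set (Fin n → (Fin d → ℝ) × ℝ) := fun φ k => {ω | ∃ f ∈ F,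
        Real.sqrt (∫ x, (f x - f₀ x) ^ 2 ∂(P.map Prod.fst)) ≤ 2 ^ k * r
          ∧ n * (Lip * (r * (2 ^ k * r) / M))
        < ∑ i, ((∫ z, lossDiff φ f f₀ z ∂P) - lossDiff φ f f₀ (ω i))} with hB
  have hBle : ∀ φ : ℝ → ℝ, (∀ a b, |φ a - φ b| ≤ Lip * |a - b|) → ∀ k,
      (Measure.pi fun _ : Fin n => P) (B φ k) ≤ ENNReal.ofReal q := fun φ hφ k =>
    measure_exists_lossDiff_gt_le P hLip0 hφ hf₀ hM hr
      (le_mul_of_one_le_left hr.le (one_le_pow₀ one_le_two)) hb₀ hE.le hn hF hFm hb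
  have hneg : ∀ a b, |(-ℓ) a - (-ℓ) b| ≤ Lip * |a - b| := fun a b => by
    rw [Pi.neg_apply, Pi.neg_apply, neg_sub_neg, abs_sub_comm]
    exact hℓ' a b
  have hsub : Sᶜ ⊆ ⋃ k ∈ Finset.range (m + 2), (B ℓ k ∪ B (-ℓ) k) := by
    intro ω hω
    simp only [hS, Set.mem_compl_iff, Set.mem_ofPred_eq, not_forall, not_le] at hω
    obtain ⟨f, hf, hlt⟩ := hω
    set s := Real.sqrt (∫ x, (f x - f₀ x) ^ 2 ∂(P.map Prod.fst)) with hs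
    have hs2 : s ≤ 2 ^ (m + 1) * r :=
      (sqrt_integral_map_fst_sq_sub_le P (hFm f hf) hf₀ hM.le (hb f hf) hb₀).trans hm2
    obtain ⟨k, hk, h1, h2⟩ := exists_two_pow_mul_ge (Real.sqrt_nonneg _) hr hs2
    have hle : n * (Lip * (r * (2 ^ k * r) / M))
        ≤ n * (2 * Lip * M⁻¹ * r * (s + r)) := by
      have e : 2 * Lip * M⁻¹ * r * (s + r) = Lip * (r * (2 * (s + r)) / M) := by
        field_simp
      rw [e]
      gcongr
    have hsum : ∀ φ : ℝ → ℝ, ∑ i, ((∫ z, lossDiff φ f f₀ z ∂P) - lossDiff φ f f₀ (ω i))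
        = n * ((∫ z, (φ (f z.1 - z.2) - φ (f₀ z.1 - z.2)) ∂P)
        - (n : ℝ)⁻¹ * ∑ i, (φ (f (ω i).1 - (ω i).2) - φ (f₀ (ω i).1 - (ω i).2))) := fun φ => by
      rw [Finset.sum_sub_distrib, mul_sub, mul_inv_cancel_left₀ hn0.ne']
      simp [lossDiff]
    refine Set.mem_biUnion (Finset.mem_coe.2 (Finset.mem_range.2 (by omega : k < m + 2))) ?_
    rcases lt_abs.1 hlt with h | h
    · refine Or.inl ⟨f, hf, h1, hle.trans_lt ?_⟩
      rw [hsum]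
      gcongr
    · refine Or.inr ⟨f, hf, h1, hle.trans_lt ?_⟩
      rw [hsum]
      gcongr
      refine h.trans_eq ?_
      simp only [Pi.neg_apply, neg_sub_neg, ← neg_sub (ℓ (f _ - _)), integral_neg,
        Finset.sum_neg_distrib]
      ring
  have hq0 : 0 ≤ q := (Real.exp_pos _).le
  have hcompl : (Measure.pi fun _ : Fin n => P) Sᶜ ≤ ENNReal.ofReal (2 * Real.exp
      (-(1 / 400 * n * r ^ 2) / (2 * M ^ 2) + 100 * Real.log l)) := by
    calc (Measure.pi fun _ : Fin n => P) Sᶜ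
        ≤ ∑ k ∈ Finset.range (m + 2), (Measure.pi fun _ : Fin n => P) (B ℓ k ∪ B (-ℓ) k) :=
          (measure_mono hsub).trans (measure_biUnion_finset_le _ _)
      _ ≤ ∑ k ∈ Finset.range (m + 2), ENNReal.ofReal (2 * q) := by
          refine Finset.sum_le_sum fun k _ => (measure_union_le _ _).trans ?_
          rw [two_mul, ENNReal.ofReal_add hq0 hq0]
          exact add_le_add (hBle ℓ hℓ' k) (hBle (-ℓ) hneg k)
      _ = ENNReal.ofReal ((m + 2) * (2 * q)) := by
          have hc : (m : ℝ) + 2 = ((m + 2 : ℕ) : ℝ) := by push_cast; rfl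
          rw [Finset.sum_const, Finset.card_range, nsmul_eq_mul, hc,
            ENNReal.ofReal_mul (Nat.cast_nonneg _), ENNReal.ofReal_natCast]
      _ ≤ _ := by
          refine ENNReal.ofReal_le_ofReal ?_
          have e1 : Real.exp (100 * Real.log l) = l ^ 100 := by
            have := Real.exp_nat_mul (Real.log l) 100
            rw [Real.exp_log (by linarith)] at this
            exact_mod_cast this
          have e2 : -(1 / 400 * n * r ^ 2) / (2 * M ^ 2) = -(n * r ^ 2 / (800 * M ^ 2)) := by
            field_simp
            norm_num
          rw [Real.exp_add, e1, e2, ← hq]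
          have hml : (m : ℝ) + 2 ≤ l ^ 100 :=
            le_trans (by linarith [Nat.ceil_lt_add_one (a := 2 * l) (by linarith)])
              (two_mul_add_three_le_pow hl1)
          nlinarith
  rw [ENNReal.ofReal_sub _ (by positivity), ENNReal.ofReal_one, tsub_le_iff_right]
  calc (1 : ℝ≥0∞) = (Measure.pi fun _ : Fin n => P) (S ∪ Sᶜ) := by
        rw [Set.union_compl_self, measure_univ]
    _ ≤ _ := (measure_union_le _ _).trans (by gcongr)
end
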